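/- arXiv:1608.08538 — 8 statements merged into one kernel-verified Lean document; each statement's English description precedes it below -/
import Mathlib

section
/- Let n ≥ 2 and p ≥ 1 be integers, let c ∈ ℝ² and let x : Fin (n-1) → ℝ² be points, all distinct from each other and from c (a straight-line drawing of the star K_{1,n-1} with center c and leaves x i). Set r_i = dist(c, x i)/2 for each leaf and r_c = (1/2)·max_i dist(c, x i). If for every point q ∈ ℝ² the number of vertices whose ply-disk contains q (i.e. the number of indices i with dist(x i, q) < r_i, plus 1 if dist(c, q) < r_c) is at most p, then (max_i dist(c, x i)) / (min_i dist(c, x i)) ≥ 3^{(n-1)/(80p) − 1}. -/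
/-- First coordinate of the four first-quadrant directions. -/
noncomputable def plyU (k : Fin 4) : ℝ := ![1, 4/5, 3/5, 0] k
/-- Second coordinate of the four first-quadrant directions. -/
noncomputable def plyW (k : Fin 4) : ℝ := ![0, 3/5, 4/5, 1] k
/-- The sign attached to a Boolean. -/
noncomputable def plySgn (s : Bool) : ℝ := if s then 1 else -1

theorem plySgn_sq (s : Bool) : plySgn s ^ 2 = 1 := by
  cases s <;> simp [plySgn]

theorem plyUW (k : Fin 4) : plyU k ^ 2 + plyW k ^ 2 = 1 := by
  fin_cases k <;> norm_num [plyU, plyW]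

theorem exists_plySgn (a : ℝ) : ∃ s, plySgn s * a = |a| := by
  rcases le_total 0 a with h | h
  · exact ⟨true, by simp [plySgn, abs_of_nonneg h]⟩
  · exact ⟨false, by simp [plySgn, abs_of_nonpos h]⟩

theorem ply_quadrant_aux (X Y d : ℝ) (hX : 0 ≤ X) (hY : 0 ≤ Y) (h : d ^ 2 = X ^ 2 + Y ^ 2)
    (hYX : Y ≤ X) : 9/10 * d ≤ X ∨ 9/10 * d ≤ 4/5 * X + 3/5 * Y := by
  by_cases h3 : 3 * Y ≤ X
  · left
    refine (fun h h0 => le_of_abs_le (abs_le_of_sq_le_sq h h0)) ?_ hX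
    nlinarith
  · right
    refine (fun h h0 => le_of_abs_le (abs_le_of_sq_le_sq h h0)) ?_ (by positivity)
    push Not at h3
    nlinarith [mul_nonneg (sub_nonneg.2 hYX) (sub_nonneg.2 h3.le)]

theorem ply_quadrant (X Y d : ℝ) (hX : 0 ≤ X) (hY : 0 ≤ Y) (h : d ^ 2 = X ^ 2 + Y ^ 2) :
    ∃ k, 9/10 * d ≤ plyU k * X + plyW k * Y := by
  rcases le_total Y X with h' | h'
  · rcases ply_quadrant_aux X Y d hX hY h h' with h1 | h1
    · exact ⟨0, by simpa [plyU, plyW] using h1⟩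
    · exact ⟨1, by simpa [plyU, plyW] using h1⟩
  · rcases ply_quadrant_aux Y X d hY hX (by linarith) h' with h1 | h1
    · exact ⟨3, by simpa [plyU, plyW] using h1⟩
    · exact ⟨2, by simp [plyU, plyW]; linarith⟩

/-- The stabbing points. -/
noncomputable def plyPt (c : EuclideanSpace ℝ (Fin 2)) (r : ℝ) (k : Fin 4) (s t : Bool) :
    EuclideanSpace ℝ (Fin 2) :=
  !₂[c 0 + r * (plySgn s * plyU k), c 1 + r * (plySgn t * plyW k)]

theorem ply_stab (c y : EuclideanSpace ℝ (Fin 2)) (r : ℝ) (hr : 0 < r)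
    (h1 : r ≤ dist c y) (h2 : dist c y < 3/2 * r) :
    ∃ k s t, dist y (plyPt c r k s t) < dist c y / 2 := by
  set d := dist c y with hd
  have hd2 : d ^ 2 = |y 0 - c 0| ^ 2 + |y 1 - c 1| ^ 2 := by
    rw [hd, dist_comm, EuclideanSpace.dist_eq, Real.sq_sqrt (by positivity)]
    simp [Real.dist_eq]
  obtain ⟨s, hs⟩ := exists_plySgn (y 0 - c 0)
  obtain ⟨t, ht⟩ := exists_plySgn (y 1 - c 1)
  obtain ⟨k, hk⟩ := ply_quadrant _ _ d (abs_nonneg _) (abs_nonneg _) hd2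
  refine ⟨k, s, t, ?_⟩
  rw [EuclideanSpace.dist_eq]
  apply (Real.sqrt_lt' (by linarith)).2
  simp only [Fin.sum_univ_two, Real.dist_eq, sq_abs, plyPt]
  simp only [Matrix.cons_val_zero, Matrix.cons_val_one]
  rw [sq_abs, sq_abs] at hd2
  rw [← hs, ← ht] at hk
  have e1 := plySgn_sq s
  have e2 := plySgn_sq t
  have e3 := plyUW k
  generalize plySgn s = σ at *
  generalize plySgn t = τ at *
  generalize plyU k = u at *
  generalize plyW k = w at *
  have e4 : (y 0 - (c 0 + r * (σ * u))) ^ 2 + (y 1 - (c 1 + r * (τ * w))) ^ 2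
      = d ^ 2 + r ^ 2 - 2 * r * (u * (σ * (y 0 - c 0)) + w * (τ * (y 1 - c 1))) := by
    rw [hd2]
    linear_combination r ^ 2 * u ^ 2 * e1 + r ^ 2 * w ^ 2 * e2 + r ^ 2 * e3
  rw [e4]
  have e5 := mul_le_mul_of_nonneg_left hk hr.le
  nlinarith [mul_nonneg (sub_nonneg.2 h1) (sub_nonneg.2 h2.le), mul_pos hr hr]


open scoped Classical in
/-- Any drawing of the star `K_{1,n-1}` (center `c`, leaves `x i`) whose ply-number is at
most `p` has edge-length ratio at least `3 ^ ((n-1)/(80p) - 1)`: here the ply-disk of a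
leaf `x i` has radius `dist c (x i) / 2`, the ply-disk of the center has radius half the
longest edge, and the ply condition says every point of the plane is in at most `p`
ply-disks. -/
theorem stmt0 (n p : ℕ) (hn : 2 ≤ n) (hp : 1 ≤ p)
    (c : EuclideanSpace ℝ (Fin 2)) (x : Fin (n - 1) → EuclideanSpace ℝ (Fin 2))
    (hinj : Function.Injective x) (hxc : ∀ i, x i ≠ c)
    (hply : ∀ q : EuclideanSpace ℝ (Fin 2),
      {i : Fin (n - 1) | dist (x i) q < dist c (x i) / 2}.ncard +
        (if dist c q <
            (1 / 2) * (Finset.univ.sup' ⟨⟨0, by omega⟩, Finset.mem_univ _⟩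
              fun i => dist c (x i))
          then 1 else 0) ≤ p) :
    (3 : ℝ) ^ (((n : ℝ) - 1) / (80 * (p : ℝ)) - 1) ≤
      (Finset.univ.sup' ⟨⟨0, by omega⟩, Finset.mem_univ _⟩ fun i => dist c (x i)) /
        (Finset.univ.inf' ⟨⟨0, by omega⟩, Finset.mem_univ _⟩ fun i => dist c (x i)) := by
  have hne : (Finset.univ : Finset (Fin (n - 1))).Nonempty := ⟨⟨0, by omega⟩, Finset.mem_univ _⟩
  set M := Finset.univ.sup' ⟨⟨0, by omega⟩, Finset.mem_univ _⟩ fun i => dist c (x i) with hM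
  set m := Finset.univ.inf' ⟨⟨0, by omega⟩, Finset.mem_univ _⟩ fun i => dist c (x i) with hm
  have hmi : ∀ i, m ≤ dist c (x i) := fun i => Finset.inf'_le _ (Finset.mem_univ i)
  have hMi : ∀ i, dist c (x i) ≤ M := fun i =>
    Finset.le_sup' (fun i => dist c (x i)) (Finset.mem_univ i)
  have hm0 : 0 < m := by
    obtain ⟨i, -, hi⟩ := Finset.exists_mem_eq_inf' hne (fun i => dist c (x i))
    have hi' : m = dist c (x i) := hi
    rw [hi']
    exact dist_pos.2 (hxc i).symm
  have hMm : 1 ≤ M / m := by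
    rw [le_div_iff₀ hm0, one_mul]
    exact (hmi ⟨0, by omega⟩).trans (hMi _)
  obtain ⟨N, hN1, hN2⟩ := exists_nat_pow_near hMm (show (1:ℝ) < 3/2 by norm_num)
  have key : ∀ i, ∃ a : Fin (N + 1) × Fin 4 × Bool × Bool,
      dist (x i) (plyPt c (m * (3/2) ^ (a.1 : ℕ)) a.2.1 a.2.2.1 a.2.2.2) < dist c (x i) / 2 := by
    intro i
    have h1 : 1 ≤ dist c (x i) / m := by
      rw [le_div_iff₀ hm0, one_mul]; exact hmi i
    obtain ⟨j, hj1, hj2⟩ := exists_nat_pow_near h1 (show (1:ℝ) < 3/2 by norm_num)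
    have hjN : j < N + 1 := by
      have : (3/2 : ℝ) ^ j < (3/2) ^ (N + 1) :=
        hj1.trans_lt ((div_le_div_of_nonneg_right (hMi i) hm0.le).trans_lt hN2)
      exact (pow_lt_pow_iff_right₀ (by norm_num)).1 this
    rw [le_div_iff₀ hm0] at hj1
    rw [div_lt_iff₀ hm0, pow_succ] at hj2
    obtain ⟨k, s, t, h⟩ := ply_stab c (x i) (m * (3/2) ^ j) (by positivity)
      (by linarith) (by linarith)
    exact ⟨⟨⟨j, hjN⟩, k, s, t⟩, h⟩
  choose f hf using key
  have hcard : n - 1 ≤ p * ((N + 1) * 16) := by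
    have := Finset.card_le_mul_card_image_of_maps_to (s := (Finset.univ : Finset (Fin (n - 1))))
      (t := Finset.univ) (f := f) (fun _ _ => Finset.mem_univ _) p (by
        intro a _
        refine le_trans ?_ ((Nat.le_add_right _ _).trans
          (hply (plyPt c (m * (3/2) ^ (a.1 : ℕ)) a.2.1 a.2.2.1 a.2.2.2)))
        rw [← Set.ncard_coe_finset]
        apply Set.ncard_le_ncard _ (Set.toFinite _)
        intro i hi
        simp only [Finset.coe_filter, Finset.mem_univ, true_and, Set.mem_setOf_eq] at hi ⊢
        rw [← hi]
        exact hf i)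
    simpa [Fintype.card_prod] using this
  have hc2 : (n : ℝ) - 1 ≤ p * ((N + 1) * 16) := by
    have : ((n - 1 : ℕ) : ℝ) ≤ ((p * ((N + 1) * 16) : ℕ) : ℝ) := by exact_mod_cast hcard
    rw [Nat.cast_sub (by omega)] at this
    push_cast at this
    exact this
  have hp0 : (0 : ℝ) < p := by exact_mod_cast hp
  have hexp : ((n : ℝ) - 1) / (80 * (p : ℝ)) - 1 ≤ (1/5 : ℝ) * N := by
    have : ((n : ℝ) - 1) / (80 * (p : ℝ)) ≤ (N + 1) / 5 := by
      rw [div_le_iff₀ (by positivity)]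
      linarith
    linarith
  have h35 : (3 : ℝ) ^ (1/5 : ℝ) ≤ 3/2 := by
    rw [one_div, Real.rpow_inv_le_iff_of_pos (by norm_num) (by norm_num) (by norm_num)]
    norm_num
  calc (3 : ℝ) ^ (((n : ℝ) - 1) / (80 * (p : ℝ)) - 1) ≤ 3 ^ ((1/5 : ℝ) * N) :=
        Real.rpow_le_rpow_of_exponent_le (by norm_num) hexp
    _ = ((3 : ℝ) ^ (1/5 : ℝ)) ^ N := by
        rw [Real.rpow_mul (by norm_num), Real.rpow_natCast]
    _ ≤ (3/2) ^ N := by gcongr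
    _ ≤ M / m := hN1
end

section
/- Let p ≥ 1 be an integer, ρ > 0 a real number, and c ∈ ℝ². Let u : Fin N → ℝ² and r : Fin N → ℝ be such that r_i > ρ for every i and each open ball B(u_i, r_i) is contained in the annulus {x ∈ ℝ² : ρ ≤ dist(c, x) ≤ 9ρ}. If every point of ℝ² lies in at most p of the balls B(u_i, r_i), then N ≤ 80p. -/
/-- At most `80 p` disks of a drawing with ply-number `p` can belong to one radius class:
if `N` open disks each of radius greater than `ρ > 0` all lie in the annulus around `c`
with inner radius `ρ` and outer radius `9ρ`, and every point of the plane lies in at most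
`p` of the disks, then `N ≤ 80 p`. -/
theorem stmt3 (p : ℕ) (hp : 1 ≤ p) (ρ : ℝ) (hρ : 0 < ρ)
    (c : EuclideanSpace ℝ (Fin 2)) (N : ℕ)
    (u : Fin N → EuclideanSpace ℝ (Fin 2)) (r : Fin N → ℝ)
    (hr : ∀ i, ρ < r i)
    (hsub : ∀ i, Metric.ball (u i) (r i) ⊆
      {x : EuclideanSpace ℝ (Fin 2) | ρ ≤ dist c x ∧ dist c x ≤ 9 * ρ})
    (hply : ∀ q : EuclideanSpace ℝ (Fin 2),
      {i : Fin N | q ∈ Metric.ball (u i) (r i)}.ncard ≤ p) :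
    N ≤ 80 * p := by
  classical
  have hbig : MeasureTheory.volume (Metric.closedBall c (9 * ρ))
      = 81 * MeasureTheory.volume (Metric.ball c ρ) := by
    rw [EuclideanSpace.volume_closedBall, EuclideanSpace.volume_ball,
      ENNReal.ofReal_mul (by norm_num), Fintype.card_fin, mul_pow, mul_assoc]
    congr 1
    norm_num
  have hvol : ∀ i, MeasureTheory.volume (Metric.ball c ρ)
      ≤ MeasureTheory.volume (Metric.ball (u i) (r i)) := by
    intro i
    rw [EuclideanSpace.volume_ball, EuclideanSpace.volume_ball]
    gcongr
    exact (hr i).le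
  have hMpos : MeasureTheory.volume (Metric.ball c ρ) ≠ 0 :=
    (Metric.measure_ball_pos MeasureTheory.volume c hρ).ne'
  have hMtop : MeasureTheory.volume (Metric.ball c ρ) ≠ ⊤ :=
    MeasureTheory.measure_ball_lt_top.ne
  set M := MeasureTheory.volume (Metric.ball c ρ) with hM
  set A : Set (EuclideanSpace ℝ (Fin 2)) := Metric.closedBall c (9 * ρ) \ Metric.ball c ρ with hA
  have hAm : MeasurableSet A := measurableSet_closedBall.diff measurableSet_ball
  have hAvol : MeasureTheory.volume A = 80 * M := by
    rw [hA, MeasureTheory.measure_sdiff _ measurableSet_ball.nullMeasurableSet hMtop, hbig]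
    · rw [← hM]
      refine ENNReal.sub_eq_of_eq_add hMtop ?_
      ring
    · exact Metric.ball_subset_closedBall.trans (Metric.closedBall_subset_closedBall (by linarith))
  have hsubA : ∀ i, Metric.ball (u i) (r i) ⊆ A := by
    intro i x hx
    have h := hsub i hx
    simp only [Set.mem_ofPred_eq] at h
    rw [dist_comm] at h
    simp only [hA, Set.mem_sdiff, Metric.mem_closedBall, Metric.mem_ball, not_lt]
    exact ⟨h.2, h.1⟩
  have hpt : ∀ x, ∑ i, (Metric.ball (u i) (r i)).indicator (1 : EuclideanSpace ℝ (Fin 2) → ENNReal) x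
      ≤ A.indicator (fun _ => (p : ENNReal)) x := by
    intro x
    by_cases hx : x ∈ A
    · rw [Set.indicator_of_mem hx]
      have h := hply x
      rw [Set.ncard_eq_toFinset_card'] at h
      simp only [Set.indicator_apply, Pi.one_apply, Finset.sum_boole]
      norm_cast
      convert h using 2
      ext i
      simp
    · rw [Set.indicator_of_notMem hx]
      refine (Finset.sum_eq_zero fun i _ => ?_).le
      exact Set.indicator_of_notMem (fun h => hx (hsubA i h)) _
  have key : (N : ENNReal) * M ≤ ((80 * p : ℕ) : ENNReal) * M := by
    calc (N : ENNReal) * M = ∑ _i : Fin N, M := by simp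
      _ ≤ ∑ i : Fin N, MeasureTheory.volume (Metric.ball (u i) (r i)) :=
          Finset.sum_le_sum fun i _ => hvol i
      _ = ∫⁻ x, ∑ i, (Metric.ball (u i) (r i)).indicator (1 : EuclideanSpace ℝ (Fin 2) → ENNReal) x := by
          rw [MeasureTheory.lintegral_finsetSum]
          · refine Finset.sum_congr rfl fun i _ => ?_
            rw [MeasureTheory.lintegral_indicator_one measurableSet_ball]
          · intro i _
            exact measurable_one.indicator measurableSet_ball
      _ ≤ ∫⁻ x, A.indicator (fun _ => (p : ENNReal)) x := MeasureTheory.lintegral_mono hpt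
      _ = p * (80 * M) := by rw [MeasureTheory.lintegral_indicator_const hAm, hAvol]
      _ = ((80 * p : ℕ) : ENNReal) * M := by push_cast; ring
  have := (ENNReal.mul_le_mul_iff_left hMpos hMtop).1 key
  exact_mod_cast this
end

section
/- Let v_0, v_1, …, v_m be points in ℝ² and set ℓ_k = dist(v_k, v_{k+1}) for 0 ≤ k ≤ m−1; assume ℓ_k > 0 for all k. Let M ≥ 1 and let 0 ≤ i_1 < i_2 < ⋯ < i_M ≤ m−1 be indices such that for every j ∈ {1, …, M} and every k with i_j < k ≤ m−1 one has ℓ_k ≤ ℓ_{i_j}/3^{k−i_j}. Then dist(v_{i_j+1}, v_m) < ℓ_{i_j}/2 for every j; that is, the point v_m lies simultaneously in all M open disks B(v_{i_j+1}, ℓ_{i_j}/2). -/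
/-- If a drawn path `v 0, …, v m` contains `M` edges (at positions `idx 1 < ⋯ < idx M`,
here `idx : ℕ → ℕ` on `j < M`) each of which dominates every edge following it — meaning
`ℓ k ≤ ℓ (idx j) / 3 ^ (k - idx j)` for all `idx j < k ≤ m - 1`, where
`ℓ k = dist (v k) (v (k+1))` — then the endpoint `v m` lies simultaneously in all `M`
open disks of radius `ℓ (idx j) / 2` centered at `v (idx j + 1)`. -/
theorem stmt6 (m : ℕ) (v : ℕ → EuclideanSpace ℝ (Fin 2))
    (hpos : ∀ k < m, 0 < dist (v k) (v (k + 1)))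
    (M : ℕ) (hM : 1 ≤ M) (idx : ℕ → ℕ)
    (hmono : ∀ j, j + 1 < M → idx j < idx (j + 1))
    (hlt : ∀ j < M, idx j < m)
    (hdom : ∀ j < M, ∀ k, idx j < k → k < m →
      dist (v k) (v (k + 1)) ≤ dist (v (idx j)) (v (idx j + 1)) / 3 ^ (k - idx j)) :
    ∀ j < M, dist (v (idx j + 1)) (v m) < dist (v (idx j)) (v (idx j + 1)) / 2 := by
  intro j hj
  have hL := hpos _ (hlt j hj)
  have key : ∀ n : ℕ, idx j + 1 + n ≤ m → dist (v (idx j + 1)) (v (idx j + 1 + n)) ≤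
      dist (v (idx j)) (v (idx j + 1)) / 2 * (1 - 1 / 3 ^ n) := by
    intro n
    induction n with
    | zero => intro _; simp
    | succ n ih =>
      intro hn
      have h1 := ih (by omega)
      have h2 := hdom j hj (idx j + 1 + n) (by omega) (by omega)
      have h3 := dist_triangle (v (idx j + 1)) (v (idx j + 1 + n)) (v (idx j + 1 + n + 1))
      have e : idx j + 1 + n - idx j = n + 1 := by omega
      rw [e] at h2
      rw [← add_assoc]
      refine h3.trans ((add_le_add h1 h2).trans (le_of_eq ?_))
      field_simp
      ring
  have hm := hlt j hj
  have h := key (m - (idx j + 1)) (by omega)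
  have e : idx j + 1 + (m - (idx j + 1)) = m := by omega
  rw [e] at h
  have hp : (0 : ℝ) < 1 / 3 ^ (m - (idx j + 1)) := by positivity
  nlinarith [mul_pos hL hp]
end

section
/- Let T be a finite tree rooted at ρ, let Γ be an injective map from the vertices of T into ℝ², let w be a vertex of T, let P be the path in T from ρ to w, and let T' be the subtree of T consisting of w and all its descendants. Suppose that every edge f of T' is dominated by at least one edge e of P, i.e. ℓ(e) ≥ 3^{s+1}·ℓ(f) where ℓ denotes the Euclidean length of the drawn edge and s is the number of edges strictly between e and f on the root-to-leaf path of T containing both. Then there exists a vertex v of P such that every vertex of T' lies in the open disk centered at Γ(v) of radius r_v, where r_v is half the maximum Euclidean length of the edges of T incident to v in the drawing Γ. -/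
theorem aux_fix {V : Type*} (ρ : V) (par : V → V) (hroot : par ρ = ρ)
    (hwf : ∀ v : V, ∃ k : ℕ, par^[k] v = ρ) (a : V) (p : ℕ) (hp : 1 ≤ p)
    (h : par^[p] a = a) : a = ρ := by
  obtain ⟨k, hk⟩ := hwf a
  have h1 : par^[p * k] a = a := by
    rw [Function.iterate_mul]
    exact Function.iterate_fixed h k
  have h2 : p * k = (p * k - k) + k := by
    have : k ≤ p * k := Nat.le_mul_of_pos_left k hp
    omega
  rw [h2, Function.iterate_add_apply, hk, Function.iterate_fixed hroot] at h1
  exact h1.symm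

theorem aux_uniq {V : Type*} (ρ : V) (par : V → V) (hroot : par ρ = ρ)
    (hwf : ∀ v : V, ∃ k : ℕ, par^[k] v = ρ) (a b : V) (ha : a ≠ ρ) (k l : ℕ)
    (hk : par^[k] b = a) (hl : par^[l] b = a) : k = l := by
  rcases lt_trichotomy k l with h | h | h
  · refine absurd (aux_fix ρ par hroot hwf a (l - k) (by omega) ?_) ha
    have : l = (l - k) + k := by omega
    rw [this, Function.iterate_add_apply, hk] at hl
    exact hl
  · exact h
  · refine absurd (aux_fix ρ par hroot hwf a (k - l) (by omega) ?_) ha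
    have : k = (k - l) + l := by omega
    rw [this, Function.iterate_add_apply, hl] at hk
    exact hk


/-- The dominated-subtree lemma. A finite rooted tree is encoded by its parent function
`par` on a finite vertex type `V` with root `ρ` (`par ρ = ρ`, and from every vertex the
root is reached by iterating `par`). Edges are the pairs `(par b, b)` with `b ≠ ρ`, and
`Γ` is an injective straight-line drawing. Let `w` be a vertex, let `T'` be the subtree
of `w` and all its descendants (vertices `u` with `par^[j] u = w` for some `j ≥ 0`), and
let `P` be the path from `ρ` to `w` (edges `(par a, a)` with `a ≠ ρ` and `par^[i] w = a`
for some `i`). If every edge of `T'` (an edge `(par b, b)` with `par^[j] b = w`, `j ≥ 1`)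
is dominated by some edge of `P` — i.e. there are `a` on `P` and `k ≥ 1` with
`par^[k] b = a` and `ℓ(par a, a) ≥ 3 ^ k · ℓ(par b, b)` (there are `s = k - 1` edges
strictly between the two edges, and `3 ^ k = 3 ^ (s+1)`) — then some vertex `v` of `P`
has all of `T'` inside its ply-disk, whose radius is half the maximum drawn length of
the edges incident to `v`. -/
theorem stmt7 {V : Type*} [Fintype V] [DecidableEq V]
    (ρ : V) (par : V → V) (hroot : par ρ = ρ)
    (hwf : ∀ v : V, ∃ k : ℕ, par^[k] v = ρ)
    (Γ : V → EuclideanSpace ℝ (Fin 2)) (hΓ : Function.Injective Γ)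
    (w : V)
    (hdom : ∀ b : V, (∃ j : ℕ, 1 ≤ j ∧ par^[j] b = w) →
      ∃ a : V, a ≠ ρ ∧ (∃ i : ℕ, par^[i] w = a) ∧
        ∃ k : ℕ, 1 ≤ k ∧ par^[k] b = a ∧
          3 ^ k * dist (Γ (par b)) (Γ b) ≤ dist (Γ (par a)) (Γ a)) :
    ∃ v : V, (∃ i : ℕ, par^[i] w = v) ∧
      ∀ u : V, (∃ j : ℕ, par^[j] u = w) →
        dist (Γ v) (Γ u) <
          (1 / 2 : ℝ) *
            ((Finset.univ.filter (fun z : V =>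
                (par z = v ∧ z ≠ ρ) ∨ (par v = z ∧ v ≠ ρ))).sup
              (fun z => nndist (Γ v) (Γ z)) : NNReal) := by
  have hwρ : w ≠ ρ := by
    intro h
    subst h
    obtain ⟨a, ha, ⟨i, hi⟩, -⟩ := hdom w ⟨1, le_rfl, hroot⟩
    rw [Function.iterate_fixed hroot] at hi
    exact ha hi.symm
  obtain ⟨d, hd⟩ := hwf w
  set L : ℕ → ℝ := fun i => dist (Γ (par (par^[i] w))) (Γ (par^[i] w)) with hL
  have hL0 : 0 < L 0 := by
    simp only [hL, Function.iterate_zero, id]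
    rw [dist_pos]
    intro h
    exact hwρ (aux_fix ρ par hroot hwf w 1 le_rfl (hΓ h))
  obtain ⟨i, -, hi⟩ := Finset.exists_max_image (Finset.range (d + 1)) (fun i => L i / 3 ^ i)
    ⟨0, by simp⟩
  set M : ℝ := L i / 3 ^ i with hM
  have hM0 : 0 < M := by
    have := hi 0 (by simp)
    simp only [pow_zero, div_one] at this
    linarith
  have hLi : L i = M * 3 ^ i := by rw [hM]; field_simp
  have hLM : ∀ m, L m ≤ M * 3 ^ m := by
    intro m
    by_cases hm : m < d + 1
    · have := hi m (by simpa using hm)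
      exact (div_le_iff₀ (by positivity)).1 this
    · have h1 : par^[m] w = ρ := by
        have : m = (m - d) + d := by omega
        rw [this, Function.iterate_add_apply, hd, Function.iterate_fixed hroot]
      have h2 : L m = 0 := by simp [hL, h1, hroot]
      rw [h2]; positivity
  have hiρ : par^[i] w ≠ ρ := by
    intro h
    have h2 : L i = 0 := by simp [hL, h, hroot]
    have : 0 < M * 3 ^ i := by positivity
    linarith
  have hA : ∀ j : ℕ, ∀ u : V, par^[j] u = w →
      dist (Γ w) (Γ u) ≤ M / 2 * (1 - 1 / 3 ^ j) := by
    intro j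
    induction j with
    | zero =>
      intro u hu
      simp only [Function.iterate_zero, id] at hu
      simp [hu]
    | succ j ih =>
      intro u hu
      have h1 := ih (par u) (by rw [← Function.iterate_succ_apply]; exact hu)
      obtain ⟨a, ha, ⟨m, hm⟩, k, -, hk, hle⟩ := hdom u ⟨j + 1, by omega, hu⟩
      have hkm : k = m + (j + 1) := by
        refine aux_uniq ρ par hroot hwf a u ha _ _ hk ?_
        rw [Function.iterate_add_apply, hu, hm]
      have h2 := hLM m
      simp only [hL, hm] at h2
      have h3 : dist (Γ (par u)) (Γ u) ≤ M * (1 / 3 ^ (j + 1)) := by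
        have h4 : (3 : ℝ) ^ m * (3 ^ (j + 1) * dist (Γ (par u)) (Γ u)) ≤ 3 ^ m * M := by
          rw [← mul_assoc, ← pow_add, ← hkm]; linarith
        have h5 := le_of_mul_le_mul_left h4 (by positivity)
        rw [mul_one_div, le_div_iff₀ (by positivity)]; linarith
      have h6 := dist_triangle (Γ w) (Γ (par u)) (Γ u)
      have h7 : M / 2 * (1 - 1 / 3 ^ j) + M * (1 / 3 ^ (j + 1)) = M / 2 * (1 - 1 / 3 ^ (j + 1)) := by
        rw [pow_succ]; field_simp; ring
      linarith
  have hB : ∀ m : ℕ, dist (Γ (par^[m] w)) (Γ w) ≤ M / 2 * (3 ^ m - 1) := by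
    intro m
    induction m with
    | zero => simp
    | succ m ih =>
      rw [Function.iterate_succ_apply', pow_succ]
      have h1 := hLM m
      simp only [hL] at h1
      have := dist_triangle (Γ (par (par^[m] w))) (Γ (par^[m] w)) (Γ w)
      linarith
  refine ⟨par^[i] w, ⟨i, rfl⟩, ?_⟩
  rintro u ⟨j, hj⟩
  have h1 := hA j u hj
  have h2 := hB i
  have h3 := dist_triangle (Γ (par^[i] w)) (Γ w) (Γ u)
  have h4 : nndist (Γ (par^[i] w)) (Γ (par (par^[i] w))) ≤
      ((Finset.univ.filter (fun z : V =>
        (par z = par^[i] w ∧ z ≠ ρ) ∨ (par (par^[i] w) = z ∧ par^[i] w ≠ ρ))).sup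
        (fun z => nndist (Γ (par^[i] w)) (Γ z)) : NNReal) :=
    Finset.le_sup (f := fun z => nndist (Γ (par^[i] w)) (Γ z)) (by simp [hiρ])
  have h5 := NNReal.coe_le_coe.2 h4
  rw [coe_nndist, dist_comm] at h5
  have h6 : 0 < M / 2 * (1 / 3 ^ j) := by positivity
  simp only [hL] at hLi
  linarith
end

section
/- Let h̄ be a positive integer, let k be an integer with −h̄ ≤ k ≤ h̄−1, and let ℓ_0, ℓ_1, …, ℓ_{h̄} be nonnegative real numbers such that ℓ_i ≤ 3^i and ℓ_i ≤ 3^{h̄−i+k+1} for every i ∈ {0, …, h̄}. Then ∑_{i=0}^{h̄} ℓ_i < 12·3^{(h̄+k)/2}. -/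
/-- Total-length bound for a root path none of whose edges dominates the root edge (of
length 1) or a chosen deep edge of length about `3 ^ k`: if `ℓ i ≤ 3 ^ i` and
`ℓ i ≤ 3 ^ (h̄ - i + k + 1)` for all `0 ≤ i ≤ h̄`, where `-h̄ ≤ k ≤ h̄ - 1`, then
`∑_{i=0}^{h̄} ℓ i < 12 · 3 ^ ((h̄ + k)/2)` (real exponent). -/
theorem stmt11 (h : ℕ) (hh : 1 ≤ h) (k : ℤ)
    (hk1 : -(h : ℤ) ≤ k) (hk2 : k ≤ (h : ℤ) - 1)
    (ℓ : ℕ → ℝ) (hnn : ∀ i ≤ h, 0 ≤ ℓ i)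
    (hb1 : ∀ i ≤ h, ℓ i ≤ (3 : ℝ) ^ i)
    (hb2 : ∀ i ≤ h, ℓ i ≤ (3 : ℝ) ^ ((h : ℤ) - (i : ℤ) + k + 1)) :
    ∑ i ∈ Finset.range (h + 1), ℓ i < 12 * (3 : ℝ) ^ (((h : ℝ) + (k : ℝ)) / 2) := by
  obtain ⟨s, hs⟩ : ∃ s : ℕ, (h : ℤ) + k = s := ⟨((h : ℤ) + k).toNat, by omega⟩
  obtain ⟨m, hm1, hm2⟩ : ∃ m : ℕ, 2 * m ≤ s ∧ s ≤ 2 * m + 1 := ⟨s / 2, by omega, by omega⟩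
  have hmh : m + 1 ≤ h := by omega
  have A : ∀ n : ℕ, n ≤ h + 1 → ∑ i ∈ Finset.range n, ℓ i ≤ ((3 : ℝ) ^ n - 1) / 2 := by
    intro n
    induction n with
    | zero => intro _; simp
    | succ n ih =>
      intro hn
      rw [Finset.sum_range_succ, pow_succ]
      have := ih (by omega)
      have := hb1 n (by omega)
      linarith
  have B : ∀ j : ℕ, m + 1 + j ≤ h + 1 → ∑ i ∈ Finset.range (m + 1 + j), ℓ i
      ≤ (3 : ℝ) ^ m * (6 - 9 / 2 * (1 / 3) ^ j) := by
    intro j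
    induction j with
    | zero =>
      intro hn
      have := A (m + 1) (by omega)
      rw [pow_succ] at this
      simp only [add_zero, pow_zero]
      linarith
    | succ j ih =>
      intro hn
      rw [← add_assoc, Finset.sum_range_succ, pow_succ]
      have h1 := ih (by omega)
      have h2 := hb2 (m + 1 + j) (by omega)
      have h3 : (3 : ℝ) ^ ((h : ℤ) - ((m + 1 + j : ℕ) : ℤ) + k + 1)
          ≤ (3 : ℝ) ^ ((m : ℤ) + 1 - (j : ℤ)) := by
        apply zpow_le_zpow_right₀ (by norm_num)
        push_cast
        omega
      have h4 : (3 : ℝ) ^ ((m : ℤ) + 1 - (j : ℤ)) = (3 : ℝ) ^ m * 3 * (1 / 3) ^ j := by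
        rw [zpow_sub₀ (by norm_num), zpow_add₀ (by norm_num)]
        simp [div_eq_mul_inv]
      linarith
  have C := B (h - m) (by omega)
  rw [show m + 1 + (h - m) = h + 1 by omega] at C
  have hp : (0 : ℝ) < 3 ^ m := by positivity
  have hq : (0 : ℝ) < 3 ^ m * (1 / 3) ^ (h - m) := by positivity
  have D : (3 : ℝ) ^ m ≤ (3 : ℝ) ^ (((h : ℝ) + (k : ℝ)) / 2) := by
    rw [← Real.rpow_natCast]
    apply Real.rpow_le_rpow_of_exponent_le (by norm_num)
    have e1 : (h : ℝ) + (k : ℝ) = s := by exact_mod_cast hs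
    have e2 : 2 * (m : ℝ) ≤ s := by exact_mod_cast hm1
    linarith
  linarith
end

section
/- Let n ≥ 2 and let p_1, …, p_n be points in ℝ² lying on a common line in this order: p_i = A + t_i·u for some point A ∈ ℝ², unit vector u ∈ ℝ², and reals t_1 < t_2 < ⋯ < t_n. Set ℓ_i = dist(p_i, p_{i+1}) for 1 ≤ i ≤ n−1, and suppose ℓ_i/2 ≤ ℓ_{i+1} ≤ 2·ℓ_i for every i ∈ {1, …, n−2}. Define r_1 = ℓ_1/2, r_n = ℓ_{n−1}/2, and r_i = (1/2)·max(ℓ_{i−1}, ℓ_i) for 1 < i < n. Then for every point q ∈ ℝ², the number of indices i with dist(p_i, q) < r_i is at most 2. -/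
/-- A 2-drawing of a path has ply-number at most 2: if the points `p 1, …, p n` lie in
this order on a common line, consecutive edge lengths differ by a factor of at most 2,
and `r i` is the ply-radius of `p i` (half the longer of the two incident edges, or half
the unique incident edge for the endpoints), then every point of the plane lies in at
most 2 of the open disks of radius `r i` around `p i`. -/
theorem stmt12 (n : ℕ) (hn : 2 ≤ n)
    (p : ℕ → EuclideanSpace ℝ (Fin 2))
    (A u : EuclideanSpace ℝ (Fin 2)) (hu : ‖u‖ = 1) (t : ℕ → ℝ)
    (hmono : ∀ i, 1 ≤ i → i < n → t i < t (i + 1))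
    (hp : ∀ i, 1 ≤ i → i ≤ n → p i = A + t i • u)
    (hratio : ∀ i, 1 ≤ i → i + 2 ≤ n →
      dist (p i) (p (i + 1)) / 2 ≤ dist (p (i + 1)) (p (i + 2)) ∧
      dist (p (i + 1)) (p (i + 2)) ≤ 2 * dist (p i) (p (i + 1)))
    (r : ℕ → ℝ)
    (hr1 : r 1 = dist (p 1) (p 2) / 2)
    (hrn : r n = dist (p (n - 1)) (p n) / 2)
    (hri : ∀ i, 1 < i → i < n →
      r i = (1 / 2) * max (dist (p (i - 1)) (p i)) (dist (p i) (p (i + 1)))) :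
    ∀ q : EuclideanSpace ℝ (Fin 2),
      {i : ℕ | 1 ≤ i ∧ i ≤ n ∧ dist (p i) q < r i}.ncard ≤ 2 := by
  intro q
  have hd : ∀ i, 1 ≤ i → i < n → dist (p i) (p (i + 1)) = t (i + 1) - t i := by
    intro i h1 h2
    have h := hmono i h1 h2
    rw [hp i h1 h2.le, hp (i + 1) (by omega) (by omega), dist_add_left, dist_eq_norm,
      ← sub_smul, norm_smul, hu, mul_one, Real.norm_eq_abs, abs_of_neg (by linarith)]
    ring
  have hD : ∀ i j, 1 ≤ i → i ≤ j → j ≤ n → t j - t i ≤ dist (p i) (p j) := by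
    intro i j h1 h2 h3
    rw [hp i h1 (by omega), hp j (by omega) h3, dist_add_left, dist_eq_norm,
      ← sub_smul, norm_smul, hu, mul_one, Real.norm_eq_abs, abs_sub_comm]
    exact le_abs_self _
  have hm : ∀ i k, 1 ≤ i → i + k ≤ n → t i ≤ t (i + k) := by
    intro i k h1
    induction k with
    | zero => intro _; simp
    | succ k ih =>
      intro h2
      have h := hmono (i + k) (by omega) (by omega)
      have h' := ih (by omega)
      rw [← add_assoc]
      linarith
  have hR : ∀ i, 1 ≤ i → i < n → r i ≤ t (i + 1) - t i := by
    intro i h1 h2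
    have hpos := hmono i h1 h2
    have e := hd i h1 h2
    rcases Nat.lt_or_ge 1 i with h | h
    · obtain ⟨k, rfl⟩ : ∃ k, i = k + 1 := ⟨i - 1, by omega⟩
      have hq := (hratio k (by omega) (by omega)).1
      rw [hri _ h h2, Nat.add_sub_cancel]
      have : max (dist (p k) (p (k + 1))) (dist (p (k + 1)) (p (k + 1 + 1)))
          ≤ 2 * (t (k + 1 + 1) - t (k + 1)) := by
        apply max_le
        · rw [← e]; linarith
        · linarith
      linarith
    · obtain rfl : i = 1 := by omega
      norm_num at e hpos ⊢
      rw [hr1, e]; linarith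
  have hL : ∀ k, 1 ≤ k → k + 1 ≤ n → r (k + 1) ≤ t (k + 1) - t k := by
    intro k h1 h2
    have hpos := hmono k h1 h2
    have e := hd k h1 h2
    rcases Nat.lt_or_ge (k + 1) n with h | h
    · have hq := (hratio k (by omega) (by omega)).2
      rw [hri _ (by omega) h, Nat.add_sub_cancel]
      have : max (dist (p k) (p (k + 1))) (dist (p (k + 1)) (p (k + 1 + 1)))
          ≤ 2 * (t (k + 1) - t k) := by
        apply max_le
        · linarith
        · rw [← e]; exact hq
      linarith
    · obtain rfl : n = k + 1 := by omega
      rw [hrn, Nat.add_sub_cancel, e]; linarith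
  have key : ∀ i j, 1 ≤ i → i + 2 ≤ j → j ≤ n → dist (p i) q < r i →
      dist (p j) q < r j → False := by
    intro i j h1 h2 h3 hi hj
    obtain ⟨k, rfl⟩ : ∃ k, j = i + 1 + k + 1 := ⟨j - i - 2, by omega⟩
    have a := hR i h1 (by omega)
    have b := hL (i + 1 + k) (by omega) h3
    have c := hm (i + 1) k (by omega) (by omega)
    have d := hD i (i + 1 + k + 1) h1 (by omega) h3
    have e := dist_triangle_right (p i) (p (i + 1 + k + 1)) q
    linarith
  rcases Set.eq_empty_or_nonempty {i : ℕ | 1 ≤ i ∧ i ≤ n ∧ dist (p i) q < r i} with h | h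
  · rw [h]; simp
  · have hmem := Nat.sInf_mem h
    set m := sInf {i : ℕ | 1 ≤ i ∧ i ≤ n ∧ dist (p i) q < r i}
    obtain ⟨m1, m2, m3⟩ := hmem
    have hsub : {i : ℕ | 1 ≤ i ∧ i ≤ n ∧ dist (p i) q < r i} ⊆ {m, m + 1} := by
      intro j hj
      have hle : m ≤ j := Nat.sInf_le hj
      obtain ⟨j1, j2, j3⟩ := hj
      have : ¬ m + 2 ≤ j := fun hh => key m j m1 hh j2 m3 j3
      simp only [Set.mem_insert_iff, Set.mem_singleton_iff]
      omega
    exact (Set.ncard_le_ncard hsub (Set.toFinite _)).trans (Set.ncard_pair (by omega)).le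
end

section
/- Let m ≥ 1 and let n_1, …, n_m be positive real numbers. Then there exist positive real numbers ℓ_0, ℓ_1, …, ℓ_{m−1} such that: (i) ℓ_0 ≥ n_1; (ii) ℓ_i ≥ n_i + n_{i+1} for every i ∈ {1, …, m−1}; (iii) ℓ_i/2 ≤ ℓ_{i+1} ≤ 2·ℓ_i for every i ∈ {0, …, m−2}; and (iv) ∑_{i=0}^{m−1} ℓ_i ≤ 6·∑_{i=1}^{m} n_i. -/
lemma w_sumA (j k : ℕ) (h : k ≤ j + 1) :
    ∑ i ∈ Finset.range k, (1 / 2 : ℝ) ^ ((i - j) + (j - i)) ≤ 2 * (1 / 2 : ℝ) ^ (j + 1 - k) := by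
  induction k with
  | zero => simp
  | succ k ih =>
    have := ih (by omega)
    rw [Finset.sum_range_succ]
    have e1 : j + 1 - k = (j - k) + 1 := by omega
    have e2 : (k - j) + (j - k) = j - k := by omega
    have e3 : j + 1 - (k + 1) = j - k := by omega
    rw [e1, pow_succ] at this
    rw [e2, e3]
    linarith

lemma w_sumB (j k : ℕ) :
    ∑ i ∈ Finset.range (j + 1 + k), (1 / 2 : ℝ) ^ ((i - j) + (j - i)) ≤ 3 - (1 / 2 : ℝ) ^ k := by
  induction k with
  | zero =>
    have := w_sumA j (j + 1) le_rfl
    simp only [Nat.sub_self, pow_zero, add_zero] at this ⊢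
    linarith
  | succ k ih =>
    rw [← add_assoc, Finset.sum_range_succ]
    have e : (j + 1 + k - j) + (j - (j + 1 + k)) = k + 1 := by omega
    rw [e, pow_succ]
    linarith

lemma w_sum (j m : ℕ) :
    ∑ i ∈ Finset.range m, (1 / 2 : ℝ) ^ ((i - j) + (j - i)) ≤ 3 := by
  have h1 : ∑ i ∈ Finset.range m, (1 / 2 : ℝ) ^ ((i - j) + (j - i)) ≤
      ∑ i ∈ Finset.range (j + 1 + m), (1 / 2 : ℝ) ^ ((i - j) + (j - i)) := by
    apply Finset.sum_le_sum_of_subset_of_nonneg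
    · intro x hx
      simp only [Finset.mem_range] at hx ⊢
      omega
    · intros; positivity
  have h2 := w_sumB j m
  have h3 : (0 : ℝ) < (1 / 2 : ℝ) ^ m := by positivity
  linarith

lemma w_step (i j : ℕ) :
    (1 / 2 : ℝ) ^ ((i - j) + (j - i)) / 2 ≤ (1 / 2 : ℝ) ^ ((i + 1 - j) + (j - (i + 1))) ∧
    (1 / 2 : ℝ) ^ ((i + 1 - j) + (j - (i + 1))) ≤ 2 * (1 / 2 : ℝ) ^ ((i - j) + (j - i)) := by
  rcases le_or_gt j i with h | h
  · have e : (i + 1 - j) + (j - (i + 1)) = ((i - j) + (j - i)) + 1 := by omega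
    have : (0 : ℝ) < (1 / 2 : ℝ) ^ ((i - j) + (j - i)) := by positivity
    rw [e, pow_succ]
    constructor <;> linarith
  · have e : (i - j) + (j - i) = ((i + 1 - j) + (j - (i + 1))) + 1 := by omega
    have : (0 : ℝ) < (1 / 2 : ℝ) ^ ((i + 1 - j) + (j - (i + 1))) := by positivity
    rw [e, pow_succ]
    constructor <;> linarith

lemma d_sum (nn : ℕ → ℝ) (k : ℕ) :
    ∑ i ∈ Finset.range (k + 1), (if i = 0 then nn 1 else nn i + nn (i + 1)) =
      2 * ∑ i ∈ Finset.Icc 1 (k + 1), nn i - nn (k + 1) := by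
  induction k with
  | zero => simp; ring
  | succ k ih =>
    rw [Finset.sum_range_succ, ih, Finset.sum_Icc_succ_top (by omega : 1 ≤ k + 1 + 1)]
    simp only [Nat.succ_ne_zero, if_false]
    ring

/-- Guarantee of algorithm DrawPath: given positive weights `nn 1, …, nn m`, there are
positive edge lengths `ℓ 0, …, ℓ (m-1)` with `ℓ 0 ≥ nn 1`, `ℓ i ≥ nn i + nn (i+1)` for
`1 ≤ i ≤ m - 1`, consecutive lengths within a factor of 2 of each other, and total length
at most `6 · ∑_{i=1}^{m} nn i`. -/
theorem stmt13 (m : ℕ) (hm : 1 ≤ m) (nn : ℕ → ℝ)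
    (hpos : ∀ i, 1 ≤ i → i ≤ m → 0 < nn i) :
    ∃ ℓ : ℕ → ℝ,
      (∀ i < m, 0 < ℓ i) ∧
      nn 1 ≤ ℓ 0 ∧
      (∀ i, 1 ≤ i → i < m → nn i + nn (i + 1) ≤ ℓ i) ∧
      (∀ i, i + 2 ≤ m → ℓ i / 2 ≤ ℓ (i + 1) ∧ ℓ (i + 1) ≤ 2 * ℓ i) ∧
      ∑ i ∈ Finset.range m, ℓ i ≤ 6 * ∑ i ∈ Finset.Icc 1 m, nn i := by
  set d : ℕ → ℝ := fun i => if i = 0 then nn 1 else nn i + nn (i + 1) with hd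
  have dpos : ∀ i ∈ Finset.range m, 0 < d i := by
    intro i hi
    have hi' := Finset.mem_range.1 hi
    simp only [hd]
    split_ifs with h0
    · exact hpos 1 le_rfl hm
    · exact add_pos (hpos i (by omega) (by omega)) (hpos (i + 1) (by omega) (by omega))
  set ℓ : ℕ → ℝ := fun i => ∑ j ∈ Finset.range m, (1 / 2 : ℝ) ^ ((i - j) + (j - i)) * d j with hl
  have key : ∀ i < m, d i ≤ ℓ i := by
    intro i hi
    have := Finset.single_le_sum (f := fun j => (1 / 2 : ℝ) ^ ((i - j) + (j - i)) * d j)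
      (s := Finset.range m)
      (fun j hj => mul_nonneg (by positivity) (dpos j hj).le) (Finset.mem_range.2 hi)
    simpa [hl] using this
  refine ⟨ℓ, ?_, ?_, ?_, ?_, ?_⟩
  · intro i hi
    exact lt_of_lt_of_le (dpos i (Finset.mem_range.2 hi)) (key i hi)
  · simpa [hd] using key 0 (by omega)
  · intro i h1 h2
    have := key i h2
    have h0 : i ≠ 0 := by omega
    simpa only [hd, h0, if_false] using this
  · intro i _
    constructor
    · simp only [hl, Finset.sum_div]
      apply Finset.sum_le_sum
      intro j hj
      have := mul_le_mul_of_nonneg_right (w_step i j).1 (dpos j hj).le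
      linarith
    · simp only [hl, Finset.mul_sum]
      apply Finset.sum_le_sum
      intro j hj
      have := mul_le_mul_of_nonneg_right (w_step i j).2 (dpos j hj).le
      linarith
  · have h1 : ∑ i ∈ Finset.range m, ℓ i ≤ 3 * ∑ j ∈ Finset.range m, d j := by
      simp only [hl]
      rw [Finset.sum_comm, Finset.mul_sum]
      apply Finset.sum_le_sum
      intro j hj
      rw [← Finset.sum_mul]
      exact mul_le_mul_of_nonneg_right (w_sum j m) (dpos j hj).le
    obtain ⟨k, rfl⟩ : ∃ k, m = k + 1 := ⟨m - 1, by omega⟩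
    have h2 := d_sum nn k
    have h3 := hpos (k + 1) hm le_rfl
    have h4 : ∑ j ∈ Finset.range (k + 1), d j =
      2 * ∑ i ∈ Finset.Icc 1 (k + 1), nn i - nn (k + 1) := h2
    linarith
end

section
/- Let T be a tree (a finite connected acyclic simple graph) with n ≥ 2 vertices in which every vertex has degree at most 6. Then there exists an injective straight-line drawing Γ of T in ℝ² such that: (i) every edge of T has Euclidean length at least 1 in Γ; (ii) all vertices of T are placed inside a closed disk of radius 6·n^{1+log₂6}; and (iii) the ply-number of Γ is at most 2·(⌊log₂ n⌋ + 1); in particular, T has a drawing with ply-number O(log n) in area O(n^{7.2}). -/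
set_option linter.unusedSectionVars false

/-- A rooted tree on `V`, given by its parent map and depth function. -/
structure PTree (V : Type*) where
  r0 : V
  p : V → V
  d : V → ℕ
  hroot : p r0 = r0
  hd : ∀ u, u ≠ r0 → d u = d (p u) + 1

namespace PTree
variable {V : Type*} [Fintype V] [DecidableEq V] (T : PTree V)

open Classical in
/-- descendants of `v` (including `v`) -/
noncomputable def D (v : V) : Finset V := Finset.univ.filter (fun u => ∃ k : ℕ, T.p^[k] u = v)

/-- children of `v` -/
def C (v : V) : Finset V := Finset.univ.filter (fun u => u ≠ T.r0 ∧ T.p u = v)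

lemma mem_D {u v : V} : u ∈ T.D v ↔ ∃ k : ℕ, T.p^[k] u = v := by simp [D]
lemma mem_C {u v : V} : u ∈ T.C v ↔ u ≠ T.r0 ∧ T.p u = v := by simp [C]

lemma self_mem (v : V) : v ∈ T.D v := T.mem_D.2 ⟨0, rfl⟩

lemma exists_child {u v : V} (h : u ∈ T.D v) (hne : u ≠ v) : ∃ c ∈ T.C v, u ∈ T.D c := by
  obtain ⟨k, hk⟩ := T.mem_D.1 h
  induction k with
  | zero => exact absurd hk hne
  | succ k ih =>
    rw [Function.iterate_succ_apply'] at hk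
    by_cases hc : T.p^[k] u = v
    · exact ih hc
    · refine ⟨T.p^[k] u, T.mem_C.2 ⟨?_, hk⟩, T.mem_D.2 ⟨k, rfl⟩⟩
      intro h0
      rw [h0, T.hroot] at hk
      exact hc (h0.trans hk)

lemma d_p_le (u : V) : T.d (T.p u) ≤ T.d u := by
  by_cases h : u = T.r0
  · rw [h, T.hroot]
  · rw [T.hd u h]; omega

lemma d_iter_le (k : ℕ) (u : V) : T.d (T.p^[k] u) ≤ T.d u := by
  induction k with
  | zero => simp
  | succ k ih => rw [Function.iterate_succ_apply']; exact (T.d_p_le _).trans ih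

lemma d_child {c v : V} (h : c ∈ T.C v) : T.d c = T.d v + 1 := by
  obtain ⟨h1, h2⟩ := T.mem_C.1 h
  rw [T.hd c h1, h2]

lemma child_sub {c v u : V} (h : c ∈ T.C v) (hu : u ∈ T.D c) : u ∈ T.D v := by
  obtain ⟨k, hk⟩ := T.mem_D.1 hu
  refine T.mem_D.2 ⟨k + 1, ?_⟩
  rw [Function.iterate_succ_apply', hk, (T.mem_C.1 h).2]

lemma child_ne {c v u : V} (h : c ∈ T.C v) (hu : u ∈ T.D c) : u ≠ v := by
  rintro rfl
  obtain ⟨k, hk⟩ := T.mem_D.1 hu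
  have := T.d_iter_le k u
  rw [hk, T.d_child h] at this
  omega

lemma child_unique_aux {c c' v u : V} (h : c ∈ T.C v) (h' : c' ∈ T.C v) (k k' : ℕ)
    (hk : T.p^[k] u = c) (hk' : T.p^[k'] u = c') (hle : k ≤ k') : c = c' := by
  obtain ⟨j, rfl⟩ := Nat.exists_eq_add_of_le' hle
  rw [Function.iterate_add_apply, hk] at hk'
  cases j with
  | zero => simpa using hk'
  | succ j =>
    rw [Function.iterate_succ_apply, (T.mem_C.1 h).2] at hk'
    have := T.d_iter_le j v
    rw [hk', T.d_child h'] at this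
    omega

lemma child_unique {c c' v u : V} (h : c ∈ T.C v) (h' : c' ∈ T.C v)
    (hu : u ∈ T.D c) (hu' : u ∈ T.D c') : c = c' := by
  obtain ⟨k, hk⟩ := T.mem_D.1 hu
  obtain ⟨k', hk'⟩ := T.mem_D.1 hu'
  rcases le_total k k' with hle | hle
  · exact T.child_unique_aux h h' k k' hk hk' hle
  · exact (T.child_unique_aux h' h k' k hk' hk hle).symm

lemma p_mem {u c : V} (hu : u ∈ T.D c) (hne : u ≠ c) : T.p u ∈ T.D c := by
  obtain ⟨k, hk⟩ := T.mem_D.1 hu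
  cases k with
  | zero => exact absurd hk hne
  | succ k => exact T.mem_D.2 ⟨k, by rwa [Function.iterate_succ_apply] at hk⟩

lemma card_D (v : V) : (T.D v).card = 1 + ∑ c ∈ T.C v, (T.D c).card := by
  have h : T.D v = insert v ((T.C v).biUnion T.D) := by
    ext u
    simp only [Finset.mem_insert, Finset.mem_biUnion]
    constructor
    · intro hu
      by_cases he : u = v
      · exact Or.inl he
      · exact Or.inr (T.exists_child hu he)
    · rintro (rfl | ⟨c, hc, hu⟩)
      · exact T.self_mem u
      · exact T.child_sub hc hu
  rw [h, Finset.card_insert_of_notMem, Finset.card_biUnion, add_comm]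
  · intro c hc c' hc' hne
    rw [Function.onFun, Finset.disjoint_left]
    intro u hu hu'
    exact hne (T.child_unique hc hc' hu hu')
  · simp only [Finset.mem_biUnion, not_exists, not_and]
    intro c hc hu
    exact T.child_ne hc hu rfl

lemma card_pos (v : V) : 1 ≤ (T.D v).card := Finset.card_pos.2 ⟨v, T.self_mem v⟩

lemma D_root : T.D T.r0 = Finset.univ := by
  ext u
  simp only [Finset.mem_univ, iff_true]
  induction hn : T.d u generalizing u with
  | zero =>
    by_cases h : u = T.r0
    · rw [h]; exact T.self_mem _
    · have := T.hd u h; omega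
  | succ n ih =>
    by_cases h : u = T.r0
    · rw [h]; exact T.self_mem _
    · have h1 := T.hd u h
      obtain ⟨k, hk⟩ := T.mem_D.1 (ih (T.p u) (by omega))
      exact T.mem_D.2 ⟨k + 1, by rwa [Function.iterate_succ_apply]⟩

end PTree

/-- radius bound -/
noncomputable def KK (n : ℕ) : ℝ := 3 * (n : ℝ) ^ 3 * (3 / 2 : ℝ) ^ (Nat.log 2 n)

lemma KK_nonneg (n : ℕ) : 0 ≤ KK n := by unfold KK; positivity

lemma KK_mono {m n : ℕ} (h : m ≤ n) : KK m ≤ KK n := by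
  unfold KK
  have : (m : ℝ) ≤ n := by exact_mod_cast h
  have h2 : (3 / 2 : ℝ) ^ (Nat.log 2 m) ≤ (3 / 2 : ℝ) ^ (Nat.log 2 n) :=
    pow_le_pow_right₀ (by norm_num) (Nat.log_mono_right h)
  gcongr

lemma KK_one : KK 1 = 3 := by simp [KK]

lemma KK_ge {n : ℕ} (h : 1 ≤ n) : 3 ≤ KK n := KK_one ▸ KK_mono h

lemma log_half {m n : ℕ} (hm : 1 ≤ m) (h : 2 * m ≤ n) : Nat.log 2 m + 1 ≤ Nat.log 2 n := by
  rw [← Nat.log_mul_base (by norm_num) (by omega)]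
  exact Nat.log_mono_right (by omega)

lemma KK_half {m n : ℕ} (h : 2 * m ≤ n) :
    KK m ≤ 2 * (m : ℝ) ^ 3 * (3 / 2 : ℝ) ^ (Nat.log 2 n) := by
  rcases Nat.eq_zero_or_pos m with rfl | hm
  · simp [KK]
  · unfold KK
    have h2 : (3 / 2 : ℝ) ^ (Nat.log 2 m + 1) ≤ (3 / 2 : ℝ) ^ (Nat.log 2 n) :=
      pow_le_pow_right₀ (by norm_num) (log_half hm h)
    rw [pow_succ] at h2
    have h3 : (0 : ℝ) ≤ (m : ℝ) ^ 3 := by positivity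
    nlinarith [mul_le_mul_of_nonneg_left h2 h3]

lemma KK_step {h m1 m3 n : ℕ} (h1 : m1 ≤ h) (h3 : m3 ≤ m1) (hn : 1 + h + m1 + 2 * m3 ≤ n) :
    3 + 8 * KK m1 + 72 * KK m3 + KK h ≤ KK n := by
  have a1 : KK m1 ≤ 2 * (m1 : ℝ) ^ 3 * (3 / 2 : ℝ) ^ (Nat.log 2 n) := KK_half (by omega)
  have a3 : KK m3 ≤ 2 * (m3 : ℝ) ^ 3 * (3 / 2 : ℝ) ^ (Nat.log 2 n) := KK_half (by omega)
  have ah : KK h ≤ 3 * (h : ℝ) ^ 3 * (3 / 2 : ℝ) ^ (Nat.log 2 n) := by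
    unfold KK
    have h2 : (3 / 2 : ℝ) ^ (Nat.log 2 h) ≤ (3 / 2 : ℝ) ^ (Nat.log 2 n) :=
      pow_le_pow_right₀ (by norm_num) (Nat.log_mono_right (by omega))
    gcongr
  have hs : (1 : ℝ) ≤ (3 / 2 : ℝ) ^ (Nat.log 2 n) := one_le_pow₀ (by norm_num)
  have key : 1 + (h : ℝ) ^ 3 + 16 / 3 * (m1 : ℝ) ^ 3 + 48 * (m3 : ℝ) ^ 3 ≤ (n : ℝ) ^ 3 := by
    have b1 : (m1 : ℝ) ≤ h := by exact_mod_cast h1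
    have b3 : (m3 : ℝ) ≤ m1 := by exact_mod_cast h3
    have bn : 1 + (h : ℝ) + m1 + 2 * m3 ≤ n := by exact_mod_cast hn
    have c3 : (0 : ℝ) ≤ m3 := by positivity
    have c1 : (0 : ℝ) ≤ m1 := by positivity
    have ch : (0 : ℝ) ≤ h := by positivity
    generalize (m1 : ℝ) = x at *
    generalize (m3 : ℝ) = z at *
    generalize (h : ℝ) = y at *
    have e1 : (1 + y + x + 2 * z) ^ 3 ≤ (n : ℝ) ^ 3 := by gcongr
    have e2 : 1 + (y + x + 2 * z) ^ 3 ≤ (1 + y + x + 2 * z) ^ 3 := by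
      have : 0 ≤ y + x + 2 * z := by positivity
      nlinarith [sq_nonneg (y + x + 2 * z)]
    obtain ⟨a, rfl⟩ : ∃ a, x = z + a := ⟨x - z, by ring⟩
    obtain ⟨b, rfl⟩ : ∃ b, y = z + a + b := ⟨y - (z + a), by ring⟩
    have ha : 0 ≤ a := by linarith
    have hb : 0 ≤ b := by linarith
    have e3 : 0 ≤ (z + a + b + (z + a) + 2 * z) ^ 3 -
      ((z + a + b) ^ 3 + 16 / 3 * (z + a) ^ 3 + 48 * z ^ 3) := by
      ring_nf
      positivity
    linarith
  have : 3 * (1 + (h : ℝ) ^ 3 + 16 / 3 * (m1 : ℝ) ^ 3 + 48 * (m3 : ℝ) ^ 3) *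
      (3 / 2 : ℝ) ^ (Nat.log 2 n) ≤ KK n := by
    unfold KK
    gcongr
  nlinarith

lemma KK_final {n : ℕ} (hn : 1 ≤ n) : KK n ≤ 6 * (n : ℝ) ^ ((1 : ℝ) + Real.logb 2 6) := by
  have hn0 : (0 : ℝ) < n := by exact_mod_cast hn
  have hn1 : (1 : ℝ) ≤ n := by exact_mod_cast hn
  have e : (1 : ℝ) + Real.logb 2 6 = 3 + Real.logb 2 (3 / 2) := by
    have : (6 : ℝ) = (3 / 2) * 2 ^ 2 := by norm_num
    rw [this, Real.logb_mul (by norm_num) (by norm_num), Real.logb_pow, Real.logb_self_eq_one (by norm_num)]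
    push_cast; ring
  have g : (3 / 2 : ℝ) ^ (Nat.log 2 n) ≤ (n : ℝ) ^ (Real.logb 2 (3 / 2)) := by
    have h1 : ((2 : ℝ) ^ (Nat.log 2 n)) ≤ n := by
      exact_mod_cast Nat.pow_log_le_self 2 (by omega)
    have h2 : (3 / 2 : ℝ) = 2 ^ (Real.logb 2 (3 / 2)) :=
      (Real.rpow_logb (by norm_num) (by norm_num) (by norm_num)).symm
    calc (3 / 2 : ℝ) ^ (Nat.log 2 n) = ((2 : ℝ) ^ (Real.logb 2 (3 / 2))) ^ (Nat.log 2 n) := by rw [← h2]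
      _ = ((2 : ℝ) ^ (Nat.log 2 n)) ^ (Real.logb 2 (3 / 2)) := by
        rw [← Real.rpow_natCast, ← Real.rpow_mul (by norm_num), mul_comm, Real.rpow_mul (by norm_num),
          Real.rpow_natCast]
      _ ≤ _ := Real.rpow_le_rpow (by positivity) h1
        (Real.logb_nonneg (by norm_num) (by norm_num))
  rw [e, Real.rpow_add hn0]
  unfold KK
  have : (n : ℝ) ^ (3 : ℝ) = (n : ℝ) ^ 3 := by exact_mod_cast Real.rpow_natCast (n : ℝ) 3
  rw [this]
  have h3 : (0 : ℝ) ≤ (n : ℝ) ^ 3 := by positivity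
  have h4 : (0 : ℝ) ≤ (n : ℝ) ^ (Real.logb 2 (3 / 2)) := by positivity
  nlinarith [mul_le_mul_of_nonneg_left g h3, mul_nonneg h3 h4]

/-- assignment of at most four light children to slots -/
lemma slots {V : Type*} [DecidableEq V] (A : Finset V) (hA : A.card ≤ 4) (m : V → ℕ) (h : ℕ)
    (hm : ∀ c ∈ A, m c ≤ h) :
    ∃ (a : V → Fin 4) (m1 m3 : ℕ), Set.InjOn a A ∧ m1 ≤ h ∧ m3 ≤ m1 ∧
      m1 + 2 * m3 ≤ ∑ c ∈ A, m c ∧ (∀ c ∈ A, m c ≤ m1) ∧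
      (∀ c ∈ A, a c = 2 ∨ a c = 3 → m c ≤ m3) := by
  rcases A.eq_empty_or_nonempty with rfl | hne
  · exact ⟨fun _ => 0, 0, 0, by simp⟩
  obtain ⟨c1, hc1, hmax1⟩ := A.exists_max_image m hne
  have s1 := Finset.add_sum_erase A m hc1
  have k1 := Finset.card_erase_of_mem hc1
  set A1 := A.erase c1 with hA1
  rcases A1.eq_empty_or_nonempty with h1 | hne1
  · refine ⟨fun _ => 0, m c1, 0, ?_, hm _ hc1, by omega, by omega, hmax1, by simp⟩
    intro x hx y hy _
    have hx' : x ∉ A1 := by simp [h1]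
    have hy' : y ∉ A1 := by simp [h1]
    simp only [hA1, Finset.mem_erase, not_and_or, not_not] at hx' hy'
    simp only [Finset.mem_coe] at hx hy
    grind
  obtain ⟨c2, hc2, hmax2⟩ := A1.exists_max_image m hne1
  have s2 := Finset.add_sum_erase A1 m hc2
  have k2 := Finset.card_erase_of_mem hc2
  set A2 := A1.erase c2 with hA2
  have hc2A : c2 ∈ A := Finset.mem_of_mem_erase hc2
  have hc21 : c2 ≠ c1 := Finset.ne_of_mem_erase hc2
  rcases A2.eq_empty_or_nonempty with h2 | hne2
  · refine ⟨fun c => if c = c1 then 0 else 1, m c1, 0, ?_, hm _ hc1, by omega, by omega, hmax1, ?_⟩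
    · intro x hx y hy hxy
      have hx' : x ∉ A2 := by simp [h2]
      have hy' : y ∉ A2 := by simp [h2]
      simp only [hA2, hA1, Finset.mem_erase, not_and_or, not_not] at hx' hy'
      simp only [Finset.mem_coe] at hx hy
      grind
    · intro c hc
      dsimp only
      split_ifs <;> simp
  obtain ⟨c3, hc3, hmax3⟩ := A2.exists_max_image m hne2
  have s3 := Finset.add_sum_erase A2 m hc3
  have k3 := Finset.card_erase_of_mem hc3
  have hc3A1 : c3 ∈ A1 := Finset.mem_of_mem_erase hc3
  have hc3A : c3 ∈ A := Finset.mem_of_mem_erase hc3A1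
  have l3 : (A2.erase c3).card ≤ 1 := by omega
  have hle32 := hmax2 c3 hc3A1
  have hle21 := hmax1 c2 hc2A
  refine ⟨fun c => if c = c1 then 0 else if c = c2 then 1 else if c = c3 then 2 else 3,
    m c1, m c3, ?_, hm _ hc1, by omega, by omega, hmax1, ?_⟩
  · intro x hx y hy hxy
    simp only [Finset.mem_coe] at hx hy
    by_contra hne
    rw [Finset.card_le_one] at l3
    have := l3 x
    simp only [hA2, hA1, Finset.mem_erase] at this
    grind
  · intro c hc h
    apply hmax3
    simp only [hA2, hA1, Finset.mem_erase]
    refine ⟨?_, ?_, hc⟩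
    · rintro rfl; simp [hc21] at h
    · rintro rfl; simp at h


/-- slot radii -/
noncomputable def srad (x z : ℝ) (i : Fin 4) : ℝ := if i = 2 ∨ i = 3 then z else x

/-- slot positions -/
noncomputable def spos (x z : ℝ) (i : Fin 4) : ℂ :=
  if i = 0 then ⟨0, 2 * x⟩ else if i = 1 then ⟨0, -(2 * x)⟩ else
    if i = 2 then ⟨2 * z, 0⟩ else ⟨-(2 * z), 0⟩

lemma norm_ge_of_sq {w : ℂ} {t : ℝ} (_ht : 0 ≤ t) (h : t ^ 2 ≤ w.re ^ 2 + w.im ^ 2) : t ≤ ‖w‖ := by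
  rw [Complex.norm_eq_sqrt_sq_add_sq]
  exact Real.le_sqrt_of_sq_le h

lemma norm_spos {x z : ℝ} (hx : 0 ≤ x) (hz : 0 ≤ z) (i : Fin 4) :
    ‖spos x z i‖ = 2 * srad x z i := by
  rw [Complex.norm_eq_sqrt_sq_add_sq]
  fin_cases i <;> simp [spos, srad] <;> exact Real.sqrt_sq (by positivity)

lemma spos_sep {x z : ℝ} (hx : 0 ≤ x) (hz : 0 ≤ z) {i j : Fin 4} (hij : i ≠ j) :
    srad x z i + srad x z j ≤ ‖spos x z i - spos x z j‖ := by
  apply norm_ge_of_sq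
  · unfold srad; split_ifs <;> positivity
  · fin_cases i <;> fin_cases j <;> first | exact absurd rfl hij | skip
    all_goals simp [spos, srad]
    all_goals nlinarith [sq_nonneg (x - z), mul_nonneg hx hz, sq_nonneg x, sq_nonneg z]

lemma spos_re {x z w : ℝ} (hx : 0 ≤ x) (hz : 0 ≤ z) (hw : 1 / 2 + 4 / 3 * x + 12 * z ≤ w)
    (i : Fin 4) : |(spos x z i).re| + srad x z i ≤ w - 1 / 2 := by
  fin_cases i <;> simp [spos, srad, abs_of_nonneg hz] <;> linarith

lemma spos_far {x z e : ℝ} (hx : 0 ≤ x) (hz : 0 ≤ z) (he : 1 / 2 + 4 / 3 * x + 12 * z ≤ e)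
    (i : Fin 4) : srad x z i + 3 / 4 * e ≤ ‖spos x z i + e‖ ∧
      srad x z i + 3 / 4 * e ≤ ‖spos x z i - e‖ := by
  have he0 : 0 ≤ e := by linarith
  constructor
  all_goals
    apply norm_ge_of_sq
    · unfold srad; split_ifs <;> positivity
    · fin_cases i
      all_goals simp [spos, srad]
      · nlinarith [sq_nonneg (7 / 4 * e - 3 * x), sq_nonneg x]
      · nlinarith [sq_nonneg (7 / 4 * e - 3 * x), sq_nonneg x]
      · nlinarith [mul_nonneg hz he0, mul_nonneg he0 (by linarith : 0 ≤ e - 12 * z), mul_nonneg hz (by linarith : 0 ≤ e - 12 * z)]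
      · nlinarith [mul_nonneg hz he0, mul_nonneg he0 (by linarith : 0 ≤ e - 12 * z), mul_nonneg hz (by linarith : 0 ≤ e - 12 * z)]

open Classical in
/-- the vertices of `A` whose disks cover `q` -/
noncomputable def cov {V : Type*} (Γ : V → ℂ) (r : V → ℝ) (A : Finset V) (q : ℂ) : Finset V :=
  A.filter (fun u => ‖Γ u - q‖ < r u)

lemma mem_cov {V : Type*} {Γ : V → ℂ} {r : V → ℝ} {A : Finset V} {q : ℂ} {u : V} :
    u ∈ cov Γ r A q ↔ u ∈ A ∧ ‖Γ u - q‖ < r u := by simp [cov]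

section Drawing
variable {V : Type*} [Fintype V] [DecidableEq V]

/-- A good drawing of the descendants of `v`, whose incoming path edge has length `f + B`. -/
structure Good (T : PTree V) (v : V) (f B : ℝ) (Γ : V → ℂ) (r : V → ℝ) : Prop where
  root : Γ v = 0
  inj : Set.InjOn Γ (T.D v)
  edge : ∀ u ∈ T.D v, u ≠ v → 1 ≤ ‖Γ u - Γ (T.p u)‖ ∧ ‖Γ u - Γ (T.p u)‖ ≤ 2 * r u ∧
    ‖Γ u - Γ (T.p u)‖ ≤ 2 * r (T.p u)
  Bge : 1 / 2 ≤ B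
  Ble : 6 * B ≤ KK (T.D v).card
  rge : (f + B) / 2 ≤ r v
  rle : r v ≤ 3 / 4 * (f + B)
  rX : r v ≤ 2 * f + KK (T.D v).card - 3 * B
  ball : ∀ u ∈ T.D v, u ≠ v → ‖Γ u‖ + r u ≤ 2 * f + KK (T.D v).card - 3 * B
  left : ∀ u ∈ T.D v, u ≠ v → - B ≤ (Γ u).re - r u
  far : ∀ u ∈ T.D v, u ≠ v → ∀ e, B ≤ e → r u + 3 / 4 * e ≤ ‖Γ u + (e : ℂ)‖
  cnt : ∀ q, (cov Γ r ((T.D v).erase v) q).card ≤ 2 * Nat.log 2 (T.D v).card + 1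
  cnt' : ∀ q, ‖q‖ < r v → (cov Γ r ((T.D v).erase v) q).card ≤ 2 * Nat.log 2 (T.D v).card

/-- A light drawing of the descendants of `c` in a disk of radius `R`. -/
structure Light (T : PTree V) (c : V) (R : ℝ) (Γ : V → ℂ) (r : V → ℝ) : Prop where
  root : Γ c = 0
  rroot : r c = R
  inj : Set.InjOn Γ (T.D c)
  edge : ∀ u ∈ T.D c, u ≠ c → 1 ≤ ‖Γ u - Γ (T.p u)‖ ∧ ‖Γ u - Γ (T.p u)‖ ≤ 2 * r u ∧
    ‖Γ u - Γ (T.p u)‖ ≤ 2 * r (T.p u)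
  rpos : ∀ u ∈ T.D c, 0 < r u
  ball : ∀ u ∈ T.D c, ‖Γ u‖ + r u ≤ R
  cnt : ∀ q, (cov Γ r (T.D c) q).card ≤ 2 * Nat.log 2 (T.D c).card + 2

lemma Good.light {T : PTree V} {c : V} {B R : ℝ} {Γ : V → ℂ} {r : V → ℝ}
    (g : Good T c 0 B Γ r) (hR : KK (T.D c).card ≤ R) :
    Light T c R Γ (Function.update r c R) := by
  have hK := KK_ge (T.card_pos c)
  have hB := g.Bge
  have hrX := g.rX
  have hr : ∀ u, u ≠ c → Function.update r c R u = r u := fun u hu => Function.update_of_ne hu _ _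
  have hrc : Function.update r c R c = R := Function.update_self ..
  have hle : ∀ u, r u ≤ Function.update r c R u := by
    intro u
    by_cases h : u = c
    · subst h; rw [hrc]; linarith
    · rw [hr u h]
  refine ⟨g.root, hrc, g.inj, ?_, ?_, ?_, ?_⟩
  · intro u hu hne
    obtain ⟨h1, h2, h3⟩ := g.edge u hu hne
    exact ⟨h1, by linarith [hle u], by linarith [hle (T.p u)]⟩
  · intro u hu
    by_cases h : u = c
    · subst h; rw [hrc]; linarith
    · obtain ⟨h1, h2, h3⟩ := g.edge u hu h
      linarith [hle u]
  · intro u hu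
    by_cases h : u = c
    · subst h; rw [hrc, g.root]; simp
    · rw [hr u h]; linarith [g.ball u hu h]
  · intro q
    have : cov Γ (Function.update r c R) (T.D c) q ⊆ insert c (cov Γ r ((T.D c).erase c) q) := by
      intro u hu
      rw [mem_cov] at hu
      rw [Finset.mem_insert, mem_cov, Finset.mem_erase]
      by_cases h : u = c
      · exact Or.inl h
      · rw [hr u h] at hu; exact Or.inr ⟨⟨h, hu.1⟩, hu.2⟩
    calc _ ≤ _ := Finset.card_le_card this
      _ ≤ _ := Finset.card_insert_le _ _
      _ ≤ _ := by have := g.cnt q; omega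

lemma good_leaf {T : PTree V} {v : V} {f : ℝ} (hf : 0 ≤ f) (hC : T.C v = ∅) :
    Good T v f (1 / 2) (fun _ => 0) (fun _ => (f + 1 / 2) / 2) := by
  have hD : ∀ u ∈ T.D v, u = v := by
    intro u hu
    by_contra h
    obtain ⟨c, hc, -⟩ := T.exists_child hu h
    simp [hC] at hc
  have hcard : (T.D v).card = 1 := by rw [T.card_D, hC]; simp
  have hE : (T.D v).erase v = ∅ := by
    ext u; simp only [Finset.mem_erase, Finset.notMem_empty, iff_false, not_and]
    exact fun h hu => h (hD u hu)
  refine ⟨rfl, ?_, ?_, le_refl _, ?_, le_refl _, ?_, ?_, ?_, ?_, ?_, ?_, ?_⟩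
  · intro a ha b hb _; rw [hD a ha, hD b hb]
  · intro u hu h; exact absurd (hD u hu) h
  · rw [hcard, KK_one]; norm_num
  · linarith
  · rw [hcard, KK_one]; linarith
  · intro u hu h; exact absurd (hD u hu) h
  · intro u hu h; exact absurd (hD u hu) h
  · intro u hu h; exact absurd (hD u hu) h
  · intro q; simp [hE, cov]
  · intro q; simp [hE, cov]


lemma glue {T : PTree V} {v h : V} (hh : h ∈ T.C v) (Γh : V → ℂ) (rh : V → ℝ) (e : ℝ)
    (o : V → ℂ) (Γl : V → V → ℂ) (rl : V → V → ℝ) (rv : ℝ) :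
    ∃ (Γ : V → ℂ) (r : V → ℝ), Γ v = 0 ∧ r v = rv ∧
      (∀ u ∈ T.D h, Γ u = e + Γh u ∧ r u = rh u) ∧
      (∀ c ∈ (T.C v).erase h, ∀ u ∈ T.D c, Γ u = o c + Γl c u ∧ r u = rl c u) := by
  classical
  have hex : ∀ u, ∃ c, u ∈ T.D v → u ≠ v → c ∈ T.C v ∧ u ∈ T.D c := by
    intro u
    by_cases hu : u ∈ T.D v ∧ u ≠ v
    · obtain ⟨c, hc, huc⟩ := T.exists_child hu.1 hu.2
      exact ⟨c, fun _ _ => ⟨hc, huc⟩⟩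
    · exact ⟨u, fun h1 h2 => absurd ⟨h1, h2⟩ hu⟩
  choose k hk using hex
  refine ⟨fun u => if u = v then 0 else if u ∈ T.D h then e + Γh u else o (k u) + Γl (k u) u,
    fun u => if u = v then rv else if u ∈ T.D h then rh u else rl (k u) u, by simp, by simp, ?_, ?_⟩
  · intro u hu
    simp [T.child_ne hh hu, hu]
  · intro c hc u hu
    have hcC := Finset.mem_of_mem_erase hc
    have hne := T.child_ne hcC hu
    have hnh : u ∉ T.D h := fun h' => Finset.ne_of_mem_erase hc (T.child_unique hcC hh hu h')
    obtain ⟨k1, k2⟩ := hk u (T.child_sub hcC hu) hne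
    have : k u = c := T.child_unique k1 hcC k2 hu
    simp [hne, hnh, this]

lemma good_step {T : PTree V} {v h : V} {f x z w B' : ℝ} (hf : 0 ≤ f) (hh : h ∈ T.C v)
    (hx : 0 ≤ x) (hz : 0 ≤ z) (hw : w = 1 / 2 + 4 / 3 * x + 12 * z)
    (hK : 6 * w + KK (T.D h).card ≤ KK (T.D v).card)
    (a : V → Fin 4) (ha : Set.InjOn a ((T.C v).erase h))
    (hlog : ∀ c ∈ (T.C v).erase h, Nat.log 2 (T.D c).card + 1 ≤ Nat.log 2 (T.D v).card)
    (hlogh : Nat.log 2 (T.D h).card ≤ Nat.log 2 (T.D v).card)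
    (hlog1 : 1 ≤ Nat.log 2 (T.D v).card)
    {Γh : V → ℂ} {rh : V → ℝ} (gh : Good T h (2 / 3 * f + w) B' Γh rh)
    {Γl : V → V → ℂ} {rl : V → V → ℝ}
    (gl : ∀ c ∈ (T.C v).erase h, Light T c (srad x z (a c)) (Γl c) (rl c))
    (hl1 : ∀ c ∈ (T.C v).erase h, 3 ≤ srad x z (a c)) :
    ∃ B Γ r, Good T v f B Γ r := by
  obtain ⟨B, hB⟩ : ∃ B, B = w + 2 / 3 * B' := ⟨_, rfl⟩
  obtain ⟨e, he⟩ : ∃ e, e = 2 / 3 * f + w + B' := ⟨_, rfl⟩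
  obtain ⟨rv, hrv⟩ : ∃ rv, rv = 3 / 4 * min (f + B) e := ⟨_, rfl⟩
  obtain ⟨Γ, r, Γv, rv', Gh, Gl⟩ := glue hh Γh rh e (fun c => spos x z (a c)) Γl rl rv
  refine ⟨B, Γ, r, ?_⟩
  have B'ge := gh.Bge
  have B'le := gh.Ble
  have hrge := gh.rge
  have hrle := gh.rle
  have hrX := gh.rX
  rw [← he] at hrge hrle
  have hwpos : 1 / 2 ≤ w := by rw [hw]; linarith
  have rv1 : rv ≤ 3 / 4 * (f + B) := by rw [hrv]; linarith [min_le_left (f + B) e]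
  have rv2 : rv ≤ 3 / 4 * e := by rw [hrv]; linarith [min_le_right (f + B) e]
  have rv3 : ∀ t, t ≤ 3 / 4 * (f + B) → t ≤ 3 / 4 * e → t ≤ rv := by
    intro t h1 h2
    rw [hrv]
    have : 4 / 3 * t ≤ min (f + B) e := le_min (by linarith) (by linarith)
    linarith
  have srx : ∀ i, srad x z i ≤ 3 / 4 * w := by
    intro i; unfold srad; split_ifs <;> rw [hw] <;> linarith
  have hcase : ∀ u ∈ T.D v, u ≠ v → u ∈ T.D h ∨ ∃ c ∈ (T.C v).erase h, u ∈ T.D c := by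
    intro u hu hne
    obtain ⟨c, hc, huc⟩ := T.exists_child hu hne
    by_cases hch : c = h
    · subst hch; exact Or.inl huc
    · exact Or.inr ⟨c, Finset.mem_erase.2 ⟨hch, hc⟩, huc⟩
  have hhD := T.self_mem h
  have Γhh : Γ h = e := by rw [(Gh h hhD).1, gh.root, add_zero]
  have rhh : r h = rh h := (Gh h hhD).2
  have ph : T.p h = v := (T.mem_C.1 hh).2
  -- light disks
  have lball : ∀ c ∈ (T.C v).erase h, ∀ u ∈ T.D c,
      ‖Γ u - spos x z (a c)‖ + r u ≤ srad x z (a c) ∧ 0 < r u := by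
    intro c hc u hu
    obtain ⟨g1, g2⟩ := Gl c hc u hu
    rw [g1, g2, add_sub_cancel_left]
    exact ⟨(gl c hc).ball u hu, (gl c hc).rpos u hu⟩
  have lre : ∀ c ∈ (T.C v).erase h, ∀ u ∈ T.D c,
      |(Γ u).re| + r u ≤ w - 1 / 2 := by
    intro c hc u hu
    have h1 := (lball c hc u hu).1
    have h2 := spos_re hx hz hw.ge (a c)
    have h3 := Complex.abs_re_le_norm (Γ u - spos x z (a c))
    rw [Complex.sub_re] at h3
    have h4 := abs_sub_abs_le_abs_sub (Γ u).re (spos x z (a c)).re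
    linarith
  have lfar : ∀ c ∈ (T.C v).erase h, ∀ u ∈ T.D c, ∀ e', w ≤ e' →
      r u + 3 / 4 * e' ≤ ‖Γ u + (e' : ℂ)‖ ∧ r u + 3 / 4 * e' ≤ ‖Γ u - (e' : ℂ)‖ := by
    intro c hc u hu e' he'
    have h1 := (lball c hc u hu).1
    obtain ⟨h2, h3⟩ := spos_far hx hz (hw.ge.trans he') (a c)
    have h4 := norm_sub_norm_le (spos x z (a c) + e') (Γ u + e')
    have h5 := norm_sub_norm_le (spos x z (a c) - e') (Γ u - e')
    rw [add_sub_add_right_eq_sub, norm_sub_rev] at h4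
    rw [sub_sub_sub_cancel_right, norm_sub_rev (spos x z (a c)) (Γ u)] at h5
    exact ⟨by linarith, by linarith⟩
  have lnorm : ∀ c ∈ (T.C v).erase h, ∀ u ∈ T.D c, ‖Γ u‖ + r u ≤ 3 * srad x z (a c) := by
    intro c hc u hu
    have h1 := (lball c hc u hu).1
    have h2 := norm_spos hx hz (a c)
    have h4 := norm_sub_norm_le (Γ u) (spos x z (a c))
    linarith
  -- heavy part
  have hpos : ∀ u ∈ T.D h, u ≠ h → 1 / 2 ≤ r u := by
    intro u hu hne
    rw [(Gh u hu).2]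
    have := gh.edge u hu hne
    linarith
  have hleft : ∀ u ∈ T.D h, u ≠ h → w ≤ (Γ u).re - r u := by
    intro u hu hne
    have := gh.left u hu hne
    rw [(Gh u hu).1, (Gh u hu).2, Complex.add_re, Complex.ofReal_re]
    linarith
  have hre : ∀ u ∈ T.D h, w ≤ (Γ u).re := by
    intro u hu
    by_cases hne : u = h
    · rw [hne, Γhh, Complex.ofReal_re]; linarith
    · linarith [hleft u hu hne, hpos u hu hne]
  -- points covered by disks
  have cre : ∀ u q, ‖Γ u - q‖ < r u → |(Γ u).re - q.re| < r u := by
    intro u q hq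
    have := Complex.abs_re_le_norm (Γ u - q)
    rw [Complex.sub_re] at this
    linarith
  -- light covering excludes others
  have lexcl : ∀ c ∈ (T.C v).erase h, ∀ u ∈ T.D c, ∀ q, ‖Γ u - q‖ < r u →
      ∀ u' ∈ (T.D v).erase v, ‖Γ u' - q‖ < r u' → u' ∈ T.D c := by
    intro c hc u hu q hq u' hu' hq'
    obtain ⟨hne', huD'⟩ := Finset.mem_erase.1 hu'
    rcases hcase u' huD' hne' with h1 | ⟨c', hc', h1⟩
    · exfalso
      by_cases hne : u' = h
      · rw [hne, Γhh, rhh] at hq'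
        have h2 := (lfar c hc u hu e (by linarith)).2
        have h3 := norm_sub_le_norm_sub_add_norm_sub (Γ u) q (e : ℂ)
        rw [norm_sub_rev q] at h3
        linarith
      · have h2 := lre c hc u hu
        have h3 := hleft u' h1 hne
        have h4 := abs_lt.1 (cre u q hq)
        have h5 := abs_lt.1 (cre u' q hq')
        have h6 := le_abs_self (Γ u).re
        linarith
    · by_cases hcc : c' = c
      · rwa [← hcc]
      · exfalso
        have haa : a c ≠ a c' := fun hh' => hcc (ha hc hc' hh').symm
        have h2 := spos_sep hx hz haa
        have h3 := (lball c hc u hu).1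
        have h4 := (lball c' hc' u' h1).1
        have h5 := norm_sub_le_norm_sub_add_norm_sub (spos x z (a c)) q (spos x z (a c'))
        have h6 := norm_sub_le_norm_sub_add_norm_sub (spos x z (a c)) (Γ u) q
        have h7 := norm_sub_le_norm_sub_add_norm_sub q (Γ u') (spos x z (a c'))
        rw [norm_sub_rev (spos x z (a c)) (Γ u)] at h6
        rw [norm_sub_rev q (Γ u')] at h7
        linarith
  have lcnt : ∀ q, (∃ c ∈ (T.C v).erase h, ∃ u ∈ T.D c, ‖Γ u - q‖ < r u) →
      (cov Γ r ((T.D v).erase v) q).card ≤ 2 * Nat.log 2 (T.D v).card := by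
    rintro q ⟨c, hc, u, hu, hq⟩
    have hsub : cov Γ r ((T.D v).erase v) q ⊆ cov (Γl c) (rl c) (T.D c) (q - spos x z (a c)) := by
      intro u' hu'
      rw [mem_cov] at hu' ⊢
      have h1 := lexcl c hc u hu q hq u' hu'.1 hu'.2
      refine ⟨h1, ?_⟩
      have h2 := hu'.2
      rw [(Gl c hc u' h1).1, (Gl c hc u' h1).2] at h2
      convert h2 using 2
      ring
    have h1 := Finset.card_le_card hsub
    have h2 := (gl c hc).cnt (q - spos x z (a c))
    have h3 := hlog c hc
    omega
  -- no light cover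
  have hcovsub : ∀ q, (¬ ∃ c ∈ (T.C v).erase h, ∃ u ∈ T.D c, ‖Γ u - q‖ < r u) →
      ∀ u ∈ cov Γ r ((T.D v).erase v) q, u ≠ h → u ∈ cov Γh rh ((T.D h).erase h) (q - e) := by
    intro q hq u hu hne
    rw [mem_cov, Finset.mem_erase] at hu
    rw [mem_cov, Finset.mem_erase]
    rcases hcase u hu.1.2 hu.1.1 with h1 | ⟨c, hc, h1⟩
    · refine ⟨⟨hne, h1⟩, ?_⟩
      have h2 := hu.2
      rw [(Gh u h1).1, (Gh u h1).2] at h2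
      convert h2 using 2
      ring
    · exact absurd ⟨c, hc, u, h1, hu.2⟩ hq
  refine ⟨Γv, ?_, ?_, by linarith, by linarith, ?_, ?_, ?_, ?_, ?_, ?_, ?_, ?_⟩
  · -- injectivity
    have i1 : ∀ u ∈ T.D v, u ≠ v → Γ u ≠ Γ v := by
      intro u hu hne heq
      rw [Γv] at heq
      rcases hcase u hu hne with h1 | ⟨c, hc, h1⟩
      · have := hre u h1
        rw [heq, Complex.zero_re] at this
        linarith
      · have h2 := lball c hc u h1
        rw [heq, zero_sub, norm_neg, norm_spos hx hz] at h2
        have := hl1 c hc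
        linarith
    have i2 : ∀ u ∈ T.D h, ∀ c ∈ (T.C v).erase h, ∀ u' ∈ T.D c, Γ u ≠ Γ u' := by
      intro u hu c hc u' hu' heq
      have h1 := hre u hu
      have h2 := lre c hc u' hu'
      have h3 := (lball c hc u' hu').2
      have h6 := le_abs_self (Γ u').re
      rw [heq] at h1
      linarith
    intro u hu u' hu' heq
    rw [Finset.mem_coe] at hu hu'
    by_cases h1 : u = v
    · by_cases h2 : u' = v
      · rw [h1, h2]
      · rw [h1] at heq; exact absurd heq.symm (i1 u' hu' h2)
    · by_cases h2 : u' = v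
      · rw [h2] at heq; exact absurd heq (i1 u hu h1)
      · rcases hcase u hu h1 with k1 | ⟨c, hc, k1⟩ <;> rcases hcase u' hu' h2 with k2 | ⟨c', hc', k2⟩
        · rw [(Gh u k1).1, (Gh u' k2).1] at heq
          exact gh.inj k1 k2 (add_left_cancel heq)
        · exact absurd heq (i2 u k1 c' hc' u' k2)
        · exact absurd heq.symm (i2 u' k2 c hc u k1)
        · have hpos' := (lball c hc u k1).2
          have hq : ‖Γ u - Γ u‖ < r u := by simpa using hpos'
          have hq' : ‖Γ u' - Γ u‖ < r u' := by rw [heq]; simpa using (lball c' hc' u' k2).2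
          have k3 := lexcl c hc u k1 (Γ u) hq u' (Finset.mem_erase.2 ⟨h2, hu'⟩) hq'
          rw [(Gl c hc u k1).1, (Gl c hc u' k3).1] at heq
          exact (gl c hc).inj k1 k3 (add_left_cancel heq)
  · -- edges
    intro u hu hne
    rcases hcase u hu hne with h1 | ⟨c, hc, h1⟩
    · by_cases h2 : u = h
      · rw [h2, ph, Γv, sub_zero, Γhh, rhh, rv', Complex.norm_real, Real.norm_eq_abs,
          abs_of_nonneg (by linarith)]
        have := rv3 (e / 2) (by linarith) (by linarith)
        exact ⟨by linarith, by linarith, by linarith⟩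
      · have h3 := T.p_mem h1 h2
        rw [(Gh u h1).1, (Gh u h1).2, (Gh _ h3).1, (Gh _ h3).2, add_sub_add_left_eq_sub]
        exact gh.edge u h1 h2
    · by_cases h2 : u = c
      · have hp : T.p c = v := (T.mem_C.1 (Finset.mem_of_mem_erase hc)).2
        rw [h2, hp, Γv, sub_zero, rv', (Gl c hc c (T.self_mem c)).1, (Gl c hc c (T.self_mem c)).2,
          (gl c hc).root, add_zero, (gl c hc).rroot, norm_spos hx hz]
        have h3 := hl1 c hc
        have h4 := srx (a c)
        have := rv3 (srad x z (a c)) (by linarith) (by linarith)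
        exact ⟨by linarith, by linarith, by linarith⟩
      · have h3 := T.p_mem h1 h2
        rw [(Gl c hc u h1).1, (Gl c hc u h1).2, (Gl c hc _ h3).1, (Gl c hc _ h3).2,
          add_sub_add_left_eq_sub]
        exact (gl c hc).edge u h1 h2
  · rw [rv']; exact rv3 _ (by linarith) (by linarith)
  · rw [rv']; exact rv1
  · rw [rv']; linarith
  · -- ball
    intro u hu hne
    rcases hcase u hu hne with h1 | ⟨c, hc, h1⟩
    · have hn : ‖Γ u‖ ≤ e + ‖Γh u‖ := by
        rw [(Gh u h1).1]
        have := norm_add_le (e : ℂ) (Γh u)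
        rwa [Complex.norm_real, Real.norm_eq_abs, abs_of_nonneg (by linarith)] at this
      rw [(Gh u h1).2]
      by_cases h2 : u = h
      · rw [h2, gh.root, norm_zero] at hn
        rw [h2]
        linarith
      · have := gh.ball u h1 h2
        linarith
    · have := lnorm c hc u h1
      have := srx (a c)
      linarith
  · -- left
    intro u hu hne
    rcases hcase u hu hne with h1 | ⟨c, hc, h1⟩
    · by_cases h2 : u = h
      · rw [h2, Γhh, rhh, Complex.ofReal_re]; linarith
      · linarith [hleft u h1 h2]
    · have h2 := lre c hc u h1
      have h3 := neg_abs_le (Γ u).re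
      linarith
  · -- far
    intro u hu hne e' he'
    have key : 0 ≤ (Γ u).re - r u → r u + 3 / 4 * e' ≤ ‖Γ u + (e' : ℂ)‖ := by
      intro h0
      have := Complex.re_le_norm (Γ u + (e' : ℂ))
      rw [Complex.add_re, Complex.ofReal_re] at this
      linarith
    rcases hcase u hu hne with h1 | ⟨c, hc, h1⟩
    · apply key
      by_cases h2 : u = h
      · rw [h2, Γhh, rhh, Complex.ofReal_re]; linarith
      · linarith [hleft u h1 h2]
    · exact (lfar c hc u h1 e' (by linarith)).1
  · -- cnt
    intro q
    by_cases hq : ∃ c ∈ (T.C v).erase h, ∃ u ∈ T.D c, ‖Γ u - q‖ < r u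
    · have := lcnt q hq; omega
    · have hs := hcovsub q hq
      by_cases hhq : ‖Γ h - q‖ < r h
      · have hsub : cov Γ r ((T.D v).erase v) q ⊆ insert h (cov Γh rh ((T.D h).erase h) (q - e)) := by
          intro u hu
          by_cases h1 : u = h
          · rw [h1]; exact Finset.mem_insert_self _ _
          · exact Finset.mem_insert_of_mem (hs u hu h1)
        have h1 := Finset.card_le_card hsub
        have h2 := Finset.card_insert_le h (cov Γh rh ((T.D h).erase h) (q - e))
        have h3 := gh.cnt' (q - e) (by rwa [Γhh, rhh, norm_sub_rev] at hhq)
        omega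
      · have hsub : cov Γ r ((T.D v).erase v) q ⊆ cov Γh rh ((T.D h).erase h) (q - e) := by
          intro u hu
          apply hs u hu
          rintro rfl
          exact hhq (mem_cov.1 hu).2
        have h1 := Finset.card_le_card hsub
        have h3 := gh.cnt (q - e)
        omega
  · -- refined count
    intro q hqv
    rw [rv'] at hqv
    by_cases hq : ∃ c ∈ (T.C v).erase h, ∃ u ∈ T.D c, ‖Γ u - q‖ < r u
    · exact lcnt q hq
    · have hs := hcovsub q hq
      have hsub : cov Γ r ((T.D v).erase v) q ⊆ {h} := by
        intro u hu
        rw [Finset.mem_singleton]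
        by_contra h1
        have h2 := hs u hu h1
        rw [mem_cov, Finset.mem_erase] at h2
        have h3 := gh.far u h2.1.2 h1 e (by linarith)
        have h4 : ‖Γh u + (e : ℂ)‖ ≤ ‖Γh u - (q - e)‖ + ‖q‖ := by
          have := norm_add_le (Γh u - (q - e)) q
          have hc : Γh u - (q - e) + q = Γh u + e := by ring
          rwa [hc] at this
        linarith [h2.2]
      have h1 := Finset.card_le_card hsub
      rw [Finset.card_singleton] at h1
      omega


lemma good_exists (T : PTree V) (hC : ∀ v, (T.C v).card ≤ 5) :
    ∀ (n : ℕ) (v : V), (T.D v).card = n → ∀ f : ℝ, 0 ≤ f → ∃ B Γ r, Good T v f B Γ r := by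
  intro n
  induction n using Nat.strong_induction_on with
  | _ n ih =>
  intro v hv f hf
  rcases (T.C v).eq_empty_or_nonempty with h0 | hne
  · exact ⟨_, _, _, good_leaf hf h0⟩
  obtain ⟨h, hh, hmax⟩ := (T.C v).exists_max_image (fun c => (T.D c).card) hne
  have hcard : ((T.C v).erase h).card ≤ 4 := by
    rw [Finset.card_erase_of_mem hh]; have := hC v; omega
  obtain ⟨a, m1, m3, ha, hm1, hm3, hsum, hA, hA3⟩ := slots ((T.C v).erase h) hcard
    (fun c => (T.D c).card) (T.D h).card (fun c hc => hmax c (Finset.mem_of_mem_erase hc))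
  have hD := T.card_D v
  rw [← Finset.add_sum_erase _ _ hh] at hD
  have hhpos := T.card_pos h
  have hlt : ∀ c ∈ T.C v, (T.D c).card < n := by
    intro c hc
    have := hmax c hc
    omega
  obtain ⟨B', Γh, rh, gh⟩ := ih _ (hlt h hh) h rfl (2 / 3 * f + (1 / 2 + 4 / 3 * KK m1 + 12 * KK m3))
    (by have := KK_nonneg m1; have := KK_nonneg m3; positivity)
  have hsr : ∀ c ∈ (T.C v).erase h, KK (T.D c).card ≤ srad (KK m1) (KK m3) (a c) := by
    intro c hc
    unfold srad
    split_ifs with h1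
    · exact KK_mono (hA3 c hc h1)
    · exact KK_mono (hA c hc)
  have hl : ∀ c, ∃ (Γ : V → ℂ) (r : V → ℝ), c ∈ (T.C v).erase h →
      Light T c (srad (KK m1) (KK m3) (a c)) Γ r := by
    intro c
    by_cases hc : c ∈ (T.C v).erase h
    · obtain ⟨B, Γ, r, g⟩ := ih _ (hlt c (Finset.mem_of_mem_erase hc)) c rfl 0 le_rfl
      exact ⟨Γ, _, fun _ => g.light (hsr c hc)⟩
    · exact ⟨fun _ => 0, fun _ => 0, fun h' => absurd h' hc⟩
  choose Γl rl hl using hl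
  have hst := KK_step (n := (T.D v).card) hm1 hm3 (by omega)
  refine good_step hf hh (KK_nonneg m1) (KK_nonneg m3) rfl (by linarith) a ha ?_ ?_ ?_ gh hl ?_
  · intro c hc
    have := hA c hc
    exact log_half (T.card_pos c) (by omega)
  · exact Nat.log_mono_right (by omega)
  · have := log_half (m := 1) (n := (T.D v).card) le_rfl (by omega)
    omega
  · intro c hc
    exact (KK_ge (T.card_pos c)).trans (hsr c hc)

lemma exists_ptree (G : SimpleGraph V) [DecidableRel G.Adj] (hT : G.IsTree) (r0 : V) :
    ∃ T : PTree V, T.r0 = r0 ∧ ∀ u v, G.Adj u v ↔ (u ≠ r0 ∧ T.p u = v) ∨ (v ≠ r0 ∧ T.p v = u) := by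
  have hex : ∀ u, ∃ w, (u = r0 → w = r0) ∧ (u ≠ r0 → G.Adj u w ∧ G.dist r0 u = G.dist r0 w + 1) := by
    intro u
    by_cases hu : u = r0
    · exact ⟨r0, fun _ => rfl, fun h => absurd hu h⟩
    · obtain ⟨w, hw⟩ := hT.connected.exists_walk_length_eq_dist u r0
      cases w with
      | nil => exact absurd rfl hu
      | @cons _ x _ hadj q =>
        refine ⟨x, fun h => absurd h hu, fun _ => ⟨hadj, ?_⟩⟩
        have h1 := SimpleGraph.dist_le q
        rw [SimpleGraph.Walk.length_cons] at hw
        have h2 := hT.dist_eq_dist_add_one_of_adj r0 hadj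
        rw [SimpleGraph.dist_comm (u := x)] at h1
        rw [SimpleGraph.dist_comm (u := u)] at hw
        omega
  choose p hp1 hp2 using hex
  have huniq : ∀ u w w', G.Adj u w → G.Adj u w' → G.dist r0 u = G.dist r0 w + 1 →
      G.dist r0 u = G.dist r0 w' + 1 → w = w' := by
    have key : ∀ u w, G.Adj u w → G.dist r0 u = G.dist r0 w + 1 →
        ∃ q : G.Walk u r0, q.IsPath ∧ q.snd = w := by
      intro u w hadj hd
      obtain ⟨q, hq⟩ := hT.connected.exists_walk_length_eq_dist w r0
      refine ⟨SimpleGraph.Walk.cons hadj q, ?_, by simp⟩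
      apply SimpleGraph.Walk.isPath_of_length_eq_dist
      rw [SimpleGraph.Walk.length_cons, hq, SimpleGraph.dist_comm, SimpleGraph.dist_comm (u := u), hd]
    intro u w w' h1 h2 h3 h4
    obtain ⟨q, hq, e1⟩ := key u w h1 h3
    obtain ⟨q', hq', e2⟩ := key u w' h2 h4
    rw [← e1, ← e2, (hT.existsUnique_path u r0).unique hq hq']
  refine ⟨⟨r0, p, fun u => G.dist r0 u, hp1 r0 rfl, fun u hu => (hp2 u hu).2⟩, rfl, ?_⟩
  intro u v
  constructor
  · intro hadj
    rcases hT.dist_eq_dist_add_one_of_adj r0 hadj with h | h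
    · left
      have hu : u ≠ r0 := by rintro rfl; simp at h
      exact ⟨hu, huniq u _ _ (hp2 u hu).1 hadj (hp2 u hu).2 h⟩
    · right
      have hv : v ≠ r0 := by rintro rfl; simp at h
      exact ⟨hv, huniq v _ _ (hp2 v hv).1 hadj.symm (hp2 v hv).2 h⟩
  · rintro (⟨hu, rfl⟩ | ⟨hv, rfl⟩)
    · exact (hp2 u hu).1
    · exact (hp2 v hv).1.symm

end Drawing

theorem stmt14 {V : Type*} [Fintype V] [DecidableEq V]
    (G : SimpleGraph V) [DecidableRel G.Adj]
    (hT : G.IsTree) (hn : 2 ≤ Fintype.card V)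
    (hdeg : ∀ v : V, G.degree v ≤ 6) :
    ∃ Γ : V → EuclideanSpace ℝ (Fin 2), Function.Injective Γ ∧
      (∀ u v : V, G.Adj u v → 1 ≤ dist (Γ u) (Γ v)) ∧
      (∃ c : EuclideanSpace ℝ (Fin 2), ∀ v : V,
        dist c (Γ v) ≤ 6 * (Fintype.card V : ℝ) ^ ((1 : ℝ) + Real.logb 2 6)) ∧
      (∀ q : EuclideanSpace ℝ (Fin 2),
        {v : V | dist (Γ v) q <
            (1 / 2 : ℝ) *
              ((G.neighborFinset v).sup (fun u => nndist (Γ v) (Γ u)) : NNReal)}.ncard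
          ≤ 2 * (Nat.log 2 (Fintype.card V) + 1)) := by
  classical
  have : Nontrivial V := Fintype.one_lt_card_iff_nontrivial.1 (by omega)
  obtain ⟨r0, hr0⟩ := hT.exists_vert_degree_one_of_nontrivial
  obtain ⟨T, hTr, hadj⟩ := exists_ptree G hT r0
  have hC : ∀ v, (T.C v).card ≤ 5 := by
    intro v
    have hsub : T.C v ⊆ G.neighborFinset v := by
      intro u hu
      rw [T.mem_C, hTr] at hu
      rw [SimpleGraph.mem_neighborFinset, hadj]
      exact Or.inr hu
    by_cases hv : v = r0
    · have := Finset.card_le_card hsub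
      rw [SimpleGraph.card_neighborFinset_eq_degree, hv, hr0] at this
      rw [hv]; omega
    · have hpn : T.p v ∈ G.neighborFinset v := by
        rw [SimpleGraph.mem_neighborFinset, hadj]
        exact Or.inl ⟨hv, rfl⟩
      have hpd : T.p v ∉ T.C v := by
        intro h
        have h1 := T.d_child h
        have h2 := T.hd v (by rwa [hTr])
        omega
      have h1 : T.C v ⊆ (G.neighborFinset v).erase (T.p v) := Finset.subset_erase.2 ⟨hsub, hpd⟩
      have h2 := Finset.card_le_card h1
      rw [Finset.card_erase_of_mem hpn, SimpleGraph.card_neighborFinset_eq_degree] at h2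
      have := hdeg v
      omega
  obtain ⟨B, Γ, r, g⟩ := good_exists T hC _ r0 rfl 0 le_rfl
  have hD : T.D r0 = Finset.univ := hTr ▸ T.D_root
  have hDc : (T.D r0).card = Fintype.card V := by rw [hD, Finset.card_univ]
  have hmem : ∀ u, u ∈ T.D r0 := fun u => by rw [hD]; exact Finset.mem_univ u
  have hne : ∀ u v, G.Adj u v → 1 ≤ ‖Γ u - Γ v‖ ∧ ‖Γ u - Γ v‖ ≤ 2 * r u := by
    intro u v huv
    rcases (hadj u v).1 huv with ⟨h1, h2⟩ | ⟨h1, h2⟩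
    · obtain ⟨a1, a2, a3⟩ := g.edge u (hmem u) h1
      rw [h2] at a1 a2
      exact ⟨a1, a2⟩
    · obtain ⟨a1, a2, a3⟩ := g.edge v (hmem v) h1
      rw [h2, norm_sub_rev] at a1 a3
      exact ⟨a1, a3⟩
  let φ := Complex.orthonormalBasisOneI.repr
  have hφ : ∀ z w : ℂ, dist (φ z) (φ w) = ‖z - w‖ := fun z w => by
    rw [φ.dist_map, dist_eq_norm]
  refine ⟨fun u => φ (Γ u), ?_, ?_, ⟨φ 0, ?_⟩, ?_⟩
  · intro u v huv
    exact g.inj (hmem u) (hmem v) (φ.injective huv)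
  · intro u v huv
    rw [hφ]
    exact (hne u v huv).1
  · intro v
    rw [hφ, zero_sub, norm_neg]
    refine le_trans ?_ (KK_final (by omega))
    have hB := g.Bge
    by_cases hv : v = r0
    · rw [hv, g.root, norm_zero]; exact KK_nonneg _
    · have h1 := g.ball v (hmem v) hv
      have h2 := g.edge v (hmem v) hv
      rw [hDc] at h1
      linarith
  · intro q
    obtain ⟨q, rfl⟩ := φ.surjective q
    have hsub : {v : V | dist (φ (Γ v)) (φ q) < (1 / 2 : ℝ) *
        ((G.neighborFinset v).sup (fun u => nndist (φ (Γ v)) (φ (Γ u))) : NNReal)} ⊆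
        ((insert r0 (cov Γ r ((T.D r0).erase r0) q) : Finset V) : Set V) := by
      intro v hv
      rw [Set.mem_ofPred_eq, hφ] at hv
      rw [Finset.mem_coe, Finset.mem_insert]
      by_cases hv0 : v = r0
      · exact Or.inl hv0
      right
      rw [mem_cov]
      refine ⟨Finset.mem_erase.2 ⟨hv0, hmem v⟩, lt_of_lt_of_le hv ?_⟩
      have hrv : 0 ≤ 2 * r v := by
        have := g.edge v (hmem v) hv0
        linarith
      have : (G.neighborFinset v).sup (fun u => nndist (φ (Γ v)) (φ (Γ u))) ≤ (2 * r v).toNNReal := by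
        apply Finset.sup_le
        intro u hu
        rw [SimpleGraph.mem_neighborFinset] at hu
        have h5 : ((nndist (φ (Γ v)) (φ (Γ u)) : NNReal) : ℝ) ≤ ((2 * r v).toNNReal : ℝ) := by
          rw [coe_nndist, hφ, Real.coe_toNNReal _ hrv]
          exact (hne v u hu).2
        exact_mod_cast h5
      have h2 := NNReal.coe_le_coe.2 this
      rw [Real.coe_toNNReal _ hrv] at h2
      linarith
    have h1 := Set.ncard_le_ncard hsub (Finset.finite_toSet _)
    rw [Set.ncard_coe_finset] at h1
    have h2 := Finset.card_insert_le r0 (cov Γ r ((T.D r0).erase r0) q)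
    have h3 := g.cnt q
    rw [hDc] at h3
    exact h1.trans (by omega)
end
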